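/- arXiv:2308.06295 — 3 statements merged into one kernel-verified Lean document; each statement's English description precedes it below -/
import Mathlib

section
/- The first root ϱ(τ) of x_τ satisfies the asymptotic expansion ϱ(τ) = (π/√(2e³))·(τ - 1/e)^{-1/2} + o((τ - 1/e)^{-1/2}) as τ → (1/e)⁺; equivalently, ϱ(τ)·√(τ - 1/e) tends to π/√(2e³) as τ tends to 1/e from the right. -/
open Real MeasureTheory Filter Set

noncomputable section

/-- `x` is the solution of `x'(t) = -x(t-τ)` with `x ≡ 1` on `(-∞,0]`:
`x(t) = 1 - ∫_0^t x(s-τ) ds` for `t ≥ 0`. -/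
def IsXSol (τ : ℝ) (x : ℝ → ℝ) : Prop :=
  Continuous x ∧ (∀ t ≤ (0:ℝ), x t = 1) ∧
    ∀ t ≥ (0:ℝ), x t = 1 - ∫ s in (0:ℝ)..t, x (s - τ)

/-- The first positive root of a function. -/
noncomputable def firstRoot (x : ℝ → ℝ) : ℝ := sInf {t : ℝ | 0 < t ∧ x t = 0}

/-- `ψ` is the solution of `ψ'(t) = max{x_τ(ϱ(τ)+t-τ), ψ(t)}` on `[0,τ]`,
`ψ'(t) = ψ(t)` on `[τ,∞)`, `ψ(0) = 0`. -/
def IsPsiSol (τ ρ : ℝ) (xτ ψ : ℝ → ℝ) : Prop :=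
  ContinuousOn ψ (Ici (0:ℝ)) ∧ ψ 0 = 0 ∧
    (∀ t ∈ Icc (0:ℝ) τ, ψ t = ∫ s in (0:ℝ)..t, max (xτ (ρ + s - τ)) (ψ s)) ∧
    (∀ t ≥ τ, ψ t = ψ τ + ∫ s in τ..t, ψ s)

/-- A (continuous, integrated-form) solution of the delay equation
`x'(t) = p(t) x(τ̄(t))` on `[t₀,∞)`. -/
def IsDelaySolution (p τd : ℝ → ℝ) (t₀ : ℝ) (x : ℝ → ℝ) : Prop :=
  Continuous x ∧ ∀ t ≥ t₀, x t = x t₀ + ∫ s in t₀..t, p s * x (τd s)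

/-- `x` is `α`-oscillating: eventually every interval on which `x` has no zero
has length at most `α`. -/
def AlphaOscillating (α : ℝ) (x : ℝ → ℝ) : Prop :=
  ∃ T : ℝ, ∀ a b : ℝ, T ≤ a → a < b → (∀ t ∈ Ioo a b, x t ≠ 0) → b - a ≤ α

/-- `x` is oscillatory: it has arbitrarily large zeros. -/
def Oscillatory (x : ℝ → ℝ) : Prop := ∀ T : ℝ, ∃ t ≥ T, x t = 0


theorem IsXSol.hasDerivAt {τ : ℝ} {x : ℝ → ℝ} (hx : IsXSol τ x) {t : ℝ} (ht : 0 < t) :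
    HasDerivAt x (-x (t - τ)) t := by
  have hc : Continuous fun s => x (s - τ) := hx.1.comp (continuous_sub_right τ)
  have h := (intervalIntegral.integral_hasDerivAt_right (hc.intervalIntegrable 0 t)
    (hc.stronglyMeasurableAtFilter _ _) hc.continuousAt).const_sub 1
  refine h.congr_of_eventuallyEq ?_
  filter_upwards [lt_mem_nhds ht] with s hs using hx.2.2 s hs.le

/-- The quotient of two solutions of `x'(t) = -x(t-τ)` keeps increasing past `t₀` if its value at
`t₀` is maximal over the preceding delay interval. -/
theorem monotoneOn_div_of_forall_le {τ t₀ T : ℝ} (hτ : 0 < τ) {f g : ℝ → ℝ} (hfc : Continuous f)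
    (hgc : Continuous g) (hf : ∀ t > t₀, HasDerivAt f (-f (t - τ)) t)
    (hg : ∀ t > t₀, HasDerivAt g (-g (t - τ)) t) (hpos : ∀ t ∈ Icc (t₀ - τ) T, 0 < g t)
    (hT : T ≤ t₀ + τ) (h0 : ∀ s ∈ Icc (t₀ - τ) t₀, f s / g s ≤ f t₀ / g t₀) :
    MonotoneOn (fun t => f t / g t) (Icc t₀ T) := by
  rcases lt_or_ge T t₀ with h | h
  · exact fun a ha => absurd (ha.1.trans ha.2) h.not_ge
  have hge : ∀ t ∈ Icc t₀ T, f t₀ / g t₀ ≤ f t / g t := by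
    set c := f t₀ / g t₀ with hc
    have hm : MonotoneOn (fun t => f t - c * g t) (Icc t₀ T) := by
      refine monotoneOn_of_hasDerivWithinAt_nonneg (convex_Icc _ _)
        (f' := fun t => -f (t - τ) - c * -g (t - τ)) (by fun_prop) ?_ ?_
      · intro t ht
        rw [interior_Icc] at ht
        exact ((hf t ht.1).sub ((hg t ht.1).const_mul c)).hasDerivWithinAt
      · intro t ht
        rw [interior_Icc] at ht
        have h1 := h0 (t - τ) ⟨by linarith [ht.1], by linarith [ht.2]⟩
        rw [div_le_iff₀ (hpos _ ⟨by linarith [ht.1], by linarith [ht.2]⟩)] at h1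
        linarith
    intro t ht
    have h1 := hm ⟨le_rfl, h⟩ ht ht.1
    have h2 : f t₀ = c * g t₀ := by
      rw [hc, div_mul_cancel₀ _ (hpos t₀ ⟨by linarith, h⟩).ne']
    rw [le_div_iff₀ (hpos t ⟨by linarith [ht.1], ht.2⟩)]
    simp only at h1
    linarith
  have hne : ∀ t ∈ Icc t₀ T, g t ≠ 0 := fun t ht => (hpos t ⟨by linarith [ht.1], ht.2⟩).ne'
  refine monotoneOn_of_hasDerivWithinAt_nonneg (convex_Icc _ _)
    (f' := fun t => (-f (t - τ) * g t - f t * -g (t - τ)) / g t ^ 2)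
    (hfc.continuousOn.div hgc.continuousOn hne) ?_ ?_
  · intro t ht
    rw [interior_Icc] at ht
    exact ((hf t ht.1).div (hg t ht.1) (hne t ⟨ht.1.le, ht.2.le⟩)).hasDerivWithinAt
  · intro t ht
    rw [interior_Icc] at ht
    have h1 := (h0 (t - τ) ⟨by linarith [ht.1], by linarith [ht.2]⟩).trans
      (hge t ⟨ht.1.le, ht.2.le⟩)
    rw [div_le_div_iff₀ (hpos _ ⟨by linarith [ht.1], by linarith [ht.2]⟩)
      (hpos _ ⟨by linarith [ht.1], by linarith [ht.2]⟩)] at h1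
    apply div_nonneg _ (sq_nonneg _)
    linarith

/-- Comparison of two solutions of `x'(t) = -x(t-τ)`, the second of which is positive. -/
theorem div_zero_le_div {τ T : ℝ} (hτ : 0 < τ) {f g : ℝ → ℝ} (hfc : Continuous f)
    (hgc : Continuous g) (hf : ∀ t > 0, HasDerivAt f (-f (t - τ)) t)
    (hg : ∀ t > 0, HasDerivAt g (-g (t - τ)) t) (hpos : ∀ t ∈ Ico (-τ) T, 0 < g t)
    (h0 : ∀ s ∈ Icc (-τ) 0, f s / g s ≤ f 0 / g 0) {t : ℝ} (ht : t ∈ Ico 0 T) :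
    f 0 / g 0 ≤ f t / g t := by
  have key : ∀ n : ℕ, ∀ t ∈ Ico 0 T, t ≤ n * τ → ∀ s ∈ Icc (-τ) t, f s / g s ≤ f t / g t := by
    intro n
    induction n with
    | zero =>
      intro t ht htn s hs
      obtain rfl : t = 0 := le_antisymm (by simpa using htn) ht.1
      exact h0 s hs
    | succ n ih =>
      intro t ht htn s hs
      rcases le_or_gt t (n * τ) with h | h
      · exact ih t ht h s hs
      push_cast at htn
      have hn : 0 ≤ n * τ := by positivity
      have hle := ih (n * τ) ⟨hn, h.trans ht.2⟩ le_rfl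
      have hm := monotoneOn_div_of_forall_le (t₀ := n * τ) (T := t) hτ hfc hgc
        (fun r hr => hf r (hn.trans_lt hr)) (fun r hr => hg r (hn.trans_lt hr))
        (fun r hr => hpos r ⟨by linarith [hr.1], hr.2.trans_lt ht.2⟩) (by linarith)
        (fun r hr => hle r ⟨by linarith [hr.1], hr.2⟩)
      rcases le_total s (n * τ) with h1 | h1
      · exact (hle s ⟨hs.1, h1⟩).trans (hm ⟨le_rfl, h.le⟩ ⟨h.le, le_rfl⟩ h.le)
      · exact hm ⟨h1, hs.2⟩ ⟨h.le, le_rfl⟩ hs.2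
  obtain ⟨n, hn⟩ := exists_nat_ge (t / τ)
  exact key n t ht ((div_le_iff₀ hτ).1 hn) 0 ⟨by linarith, ht.1⟩

/-- The delay `τ` for which `x'(t) = -x(t-τ)` has oscillating exponential solutions of
frequency `θ / τ`. -/
def delayOfPhase (θ : ℝ) : ℝ := θ / sin θ * exp (-(θ * cos θ / sin θ))

theorem delayOfPhase_pos {θ : ℝ} (h0 : 0 < θ) (hπ : θ < π) : 0 < delayOfPhase θ :=
  mul_pos (div_pos h0 (sin_pos_of_pos_of_lt_pi h0 hπ)) (exp_pos _)

/-- The oscillating exponential solution of `x'(t) = -x(t - delayOfPhase θ)` of phase `φ`. -/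
def oscSol (θ φ t : ℝ) : ℝ :=
  exp (-(θ / delayOfPhase θ * (cos θ / sin θ) * t)) * sin (θ / delayOfPhase θ * t + φ)

theorem continuous_oscSol (θ φ : ℝ) : Continuous (oscSol θ φ) := by
  unfold oscSol
  fun_prop

theorem oscSol_hasDerivAt {θ : ℝ} (h0 : 0 < θ) (hπ : θ < π) (φ t : ℝ) :
    HasDerivAt (oscSol θ φ) (-oscSol θ φ (t - delayOfPhase θ)) t := by
  have hs := sin_pos_of_pos_of_lt_pi h0 hπ
  have hF := delayOfPhase_pos h0 hπ
  have hd : delayOfPhase θ = θ / sin θ * exp (-(θ * cos θ / sin θ)) := rfl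
  set τ := delayOfPhase θ with hτ
  set ω := θ / τ with hω
  have hωτ : ω * τ = θ := div_mul_cancel₀ _ hF.ne'
  have hexp : exp (θ * cos θ / sin θ) = ω / sin θ := by
    rw [exp_neg] at hd
    have := exp_pos (θ * cos θ / sin θ)
    rw [hω, hd]
    field_simp
  have h1 : HasDerivAt (fun t => -(ω * (cos θ / sin θ) * t)) (-(ω * (cos θ / sin θ) * 1)) t :=
    ((hasDerivAt_id t).const_mul _).neg
  have h2 : HasDerivAt (fun t => ω * t + φ) (ω * 1) t :=
    ((hasDerivAt_id t).const_mul _).add_const φ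
  refine (h1.exp.mul h2.sin).congr_deriv ?_
  have e1 : -(ω * (cos θ / sin θ) * (t - τ)) =
      -(ω * (cos θ / sin θ) * t) + θ * cos θ / sin θ := by
    rw [← hωτ]; ring
  have e2 : ω * (t - τ) + φ = (ω * t + φ) - θ := by rw [← hωτ]; ring
  simp only [oscSol, ← hτ, ← hω]
  rw [e1, e2, exp_add, hexp, sin_sub]
  field_simp
  ring

theorem oscSol_pos {θ φ t : ℝ} (h1 : 0 < θ / delayOfPhase θ * t + φ)
    (h2 : θ / delayOfPhase θ * t + φ < π) : 0 < oscSol θ φ t :=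
  mul_pos (exp_pos _) (sin_pos_of_pos_of_lt_pi h1 h2)

theorem IsXSol.pos_of_forall_ne {τ T : ℝ} {x : ℝ → ℝ} (hx : IsXSol τ x)
    (h : ∀ t, 0 < t → t < T → x t ≠ 0) {t : ℝ} (ht : t < T) : 0 < x t := by
  rcases le_or_gt t 0 with h0 | h0
  · simp [hx.2.1 t h0]
  by_contra! hneg
  obtain ⟨s, hs, hs0⟩ := intermediate_value_Icc' h0.le hx.1.continuousOn
    ⟨hneg, (hx.2.1 0 le_rfl).symm ▸ zero_le_one⟩
  rcases hs.1.eq_or_lt with rfl | hs1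
  · simp [hx.2.1 0 le_rfl] at hs0
  · exact h s hs1 (hs.2.trans_lt ht) hs0

theorem IsXSol.exists_root {θ : ℝ} (h0 : 0 < θ) (hπ : θ < π) {x : ℝ → ℝ}
    (hx : IsXSol (delayOfPhase θ) x) :
    ∃ t, 0 < t ∧ t < π / (θ / delayOfPhase θ) + delayOfPhase θ ∧ x t = 0 := by
  have hF := delayOfPhase_pos h0 hπ
  by_contra! hno
  have hpos : ∀ {t}, t < π / (θ / delayOfPhase θ) + delayOfPhase θ → 0 < x t :=
    fun ht => hx.pos_of_forall_ne hno ht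
  have hy0 : oscSol θ 0 0 = 0 := by simp [oscSol]
  have hω : 0 < θ / delayOfPhase θ := by positivity
  have hωτ : θ / delayOfPhase θ * delayOfPhase θ = θ := div_mul_cancel₀ _ hF.ne'
  have hq := div_zero_le_div (f := oscSol θ 0) (g := x)
    (T := π / (θ / delayOfPhase θ) + delayOfPhase θ) (t := π / (θ / delayOfPhase θ) +
      delayOfPhase θ / 2) hF (continuous_oscSol θ 0) hx.1
    (fun t _ => oscSol_hasDerivAt h0 hπ 0 t) (fun t ht => hx.hasDerivAt ht)
    (fun t ht => hpos ht.2) ?_ ⟨by positivity, by linarith⟩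
  · rw [hy0, zero_div] at hq
    have hy : oscSol θ 0 (π / (θ / delayOfPhase θ) + delayOfPhase θ / 2) < 0 := by
      refine mul_neg_of_pos_of_neg (exp_pos _) ?_
      have e : θ / delayOfPhase θ * (π / (θ / delayOfPhase θ) + delayOfPhase θ / 2) + 0 =
          θ / 2 + π := by
        rw [mul_add, mul_div_cancel₀ _ hω.ne', ← mul_div_assoc, hωτ]; ring
      rw [e, sin_add_pi]
      linarith [sin_pos_of_pos_of_lt_pi (half_pos h0) (by linarith)]
    exact absurd hq (not_le.2 (div_neg_of_neg_of_pos hy (hpos (by linarith))))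
  · intro s hs
    rw [hy0, zero_div]
    refine div_nonpos_of_nonpos_of_nonneg ?_ (by simp [hx.2.1 s hs.2])
    refine mul_nonpos_of_nonneg_of_nonpos (exp_pos _).le
      (sin_nonpos_of_nonpos_of_neg_pi_le ?_ ?_)
    · nlinarith [hs.2]
    · nlinarith [hs.1]

theorem IsXSol.pos_of_lt {θ : ℝ} (h0 : 0 < θ) (hπ : θ < π / 2) {x : ℝ → ℝ}
    (hx : IsXSol (delayOfPhase θ) x) {t : ℝ} (ht0 : 0 ≤ t)
    (ht : t < π / (θ / delayOfPhase θ) - 2 * delayOfPhase θ) : 0 < x t := by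
  have hπ' : θ < π := by linarith [pi_pos]
  have hF := delayOfPhase_pos h0 hπ'
  have hω : 0 < θ / delayOfPhase θ := by positivity
  have hωτ : θ / delayOfPhase θ * delayOfPhase θ = θ := div_mul_cancel₀ _ hF.ne'
  have hpos : ∀ s, -(2 * delayOfPhase θ) < s →
      s < π / (θ / delayOfPhase θ) - 2 * delayOfPhase θ → 0 < oscSol θ (2 * θ) s := by
    intro s hs1 hs2
    rw [lt_sub_iff_add_lt, lt_div_iff₀ hω] at hs2
    exact oscSol_pos (by nlinarith) (by nlinarith)
  have hanti : AntitoneOn (oscSol θ (2 * θ)) (Icc (-delayOfPhase θ) 0) := by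
    refine antitoneOn_of_hasDerivWithinAt_nonpos (convex_Icc _ _)
      (f' := fun t => -oscSol θ (2 * θ) (t - delayOfPhase θ))
      (continuous_oscSol _ _).continuousOn
      (fun t _ => (oscSol_hasDerivAt h0 hπ' _ t).hasDerivWithinAt) ?_
    intro s hs
    rw [interior_Icc] at hs
    have := hpos (s - delayOfPhase θ) (by linarith [hs.1]) (by linarith [hs.2])
    linarith
  have h00 := hpos 0 (by linarith) (by linarith)
  have hq := div_zero_le_div (f := x) (g := oscSol θ (2 * θ)) hF hx.1 (continuous_oscSol _ _)
    (fun t ht => hx.hasDerivAt ht) (fun t _ => oscSol_hasDerivAt h0 hπ' _ t)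
    (fun s hs => hpos s (by linarith [hs.1]) hs.2) ?_ ⟨ht0, ht⟩
  · have h1 : 0 < x 0 / oscSol θ (2 * θ) 0 := div_pos (by simp [hx.2.1 0 le_rfl]) h00
    have h2 := hpos t (by linarith) ht
    exact (div_pos_iff_of_pos_right h2).1 (h1.trans_le hq)
  · intro s hs
    rw [hx.2.1 s hs.2, hx.2.1 0 le_rfl]
    exact one_div_le_one_div_of_le h00 (hanti hs ⟨by linarith, le_rfl⟩ hs.2)

theorem IsXSol.firstRoot_mem_Icc {θ : ℝ} (h0 : 0 < θ) (hπ : θ < π / 2) {x : ℝ → ℝ}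
    (hx : IsXSol (delayOfPhase θ) x) :
    firstRoot x ∈ Icc (π / (θ / delayOfPhase θ) - 2 * delayOfPhase θ)
      (π / (θ / delayOfPhase θ) + delayOfPhase θ) := by
  obtain ⟨t, ht0, htT, hxt⟩ := hx.exists_root h0 (by linarith [pi_pos])
  constructor
  · refine le_csInf ⟨t, ht0, hxt⟩ fun s hs => ?_
    by_contra! hlt
    exact (hx.pos_of_lt h0 hπ hs.1.le hlt).ne' hs.2
  · exact le_trans (csInf_le ⟨0, fun s hs => hs.1.le⟩ (show 0 < t ∧ x t = 0 from ⟨ht0, hxt⟩)) htT.le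

theorem tendsto_sin_div_sub_one_div_sq :
    Tendsto (fun θ => (sin θ / θ - 1) / θ ^ 2) (nhdsWithin 0 (Ioi 0)) (nhds (-(1 / 6))) := by
  have hz : Tendsto (fun θ : ℝ => θ ^ 2 * (1 / 100)) (nhdsWithin 0 (Ioi 0)) (nhds 0) :=
    tendsto_nhdsWithin_of_tendsto_nhds (by
      simpa using ((continuous_pow 2).mul_const (1 / 100 : ℝ)).tendsto 0)
  rw [tendsto_iff_norm_sub_tendsto_zero]
  refine squeeze_zero' (Eventually.of_forall fun _ => norm_nonneg _) ?_ hz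
  filter_upwards [Ioo_mem_nhdsGT (zero_lt_one' ℝ)] with θ hθ
  have hb := sin_bound (x := θ) (by rw [abs_of_pos hθ.1]; exact hθ.2.le)
  have e : (sin θ / θ - 1) / θ ^ 2 - -(1 / 6) = (sin θ - (θ - θ ^ 3 / 6)) / θ ^ 3 := by
    have := hθ.1.ne'
    field_simp
    ring
  have h3 : 0 < θ ^ 3 := pow_pos hθ.1 3
  rw [e, norm_eq_abs, abs_div, abs_of_pos h3, div_le_iff₀ h3]
  rw [abs_of_pos hθ.1] at hb
  linarith

theorem tendsto_cos_sub_one_div_sq :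
    Tendsto (fun θ => (cos θ - 1) / θ ^ 2) (nhdsWithin 0 (Ioi 0)) (nhds (-(1 / 2))) := by
  have hz : Tendsto (fun θ : ℝ => θ ^ 2 * (5 / 96)) (nhdsWithin 0 (Ioi 0)) (nhds 0) :=
    tendsto_nhdsWithin_of_tendsto_nhds (by
      simpa using ((continuous_pow 2).mul_const (5 / 96 : ℝ)).tendsto 0)
  rw [tendsto_iff_norm_sub_tendsto_zero]
  refine squeeze_zero' (Eventually.of_forall fun _ => norm_nonneg _) ?_ hz
  filter_upwards [Ioo_mem_nhdsGT (zero_lt_one' ℝ)] with θ hθ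
  have hb := cos_bound (x := θ) (by rw [abs_of_pos hθ.1]; exact hθ.2.le)
  have e : (cos θ - 1) / θ ^ 2 - -(1 / 2) = (cos θ - (1 - θ ^ 2 / 2)) / θ ^ 2 := by
    have := hθ.1.ne'
    field_simp
    ring
  have h3 : 0 < θ ^ 2 := pow_pos hθ.1 2
  rw [e, norm_eq_abs, abs_div, abs_of_pos h3, div_le_iff₀ h3]
  rw [abs_of_pos hθ.1] at hb
  linarith

theorem tendsto_delayOfPhase_sub_div_sq :
    Tendsto (fun θ => (delayOfPhase θ - 1 / exp 1) / θ ^ 2) (nhdsWithin 0 (Ioi 0))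
      (nhds (1 / (2 * exp 1))) := by
  have hsq : Tendsto (fun θ : ℝ => θ ^ 2) (nhdsWithin 0 (Ioi 0)) (nhds 0) :=
    tendsto_nhdsWithin_of_tendsto_nhds (by simpa using (continuous_pow 2).tendsto (0 : ℝ))
  have hpos : ∀ᶠ θ : ℝ in nhdsWithin 0 (Ioi 0), 0 < θ ∧ 0 < sin θ := by
    filter_upwards [Ioo_mem_nhdsGT pi_pos] with θ hθ
    exact ⟨hθ.1, sin_pos_of_pos_of_lt_pi hθ.1 hθ.2⟩
  have hS : Tendsto (fun θ => sin θ / θ) (nhdsWithin 0 (Ioi 0)) (nhds 1) := by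
    have h := (tendsto_sin_div_sub_one_div_sq.mul hsq).add_const 1
    rw [mul_zero, zero_add] at h
    refine h.congr' ?_
    filter_upwards [hpos] with θ hθ
    have := hθ.1.ne'
    field_simp
    ring
  have hS' : Tendsto (fun θ => (sin θ / θ)⁻¹) (nhdsWithin 0 (Ioi 0)) (nhds 1) := by
    simpa using hS.inv₀ one_ne_zero
  have hC : Tendsto (fun θ => cos θ * (sin θ / θ)⁻¹) (nhdsWithin 0 (Ioi 0)) (nhds 1) := by
    have hc : Tendsto cos (nhdsWithin 0 (Ioi 0)) (nhds 1) :=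
      tendsto_nhdsWithin_of_tendsto_nhds (by simpa using continuous_cos.tendsto 0)
    simpa using hc.mul hS'
  have hE : HasDerivAt (fun c => exp (-c)) (-exp (-1)) 1 := by
    simpa using (hasDerivAt_neg (1 : ℝ)).exp
  have hD : Tendsto (fun θ => dslope (fun c => exp (-c)) 1 (cos θ * (sin θ / θ)⁻¹))
      (nhdsWithin 0 (Ioi 0)) (nhds (-exp (-1))) := by
    have h := (continuousAt_dslope_same.2 hE.differentiableAt).tendsto
    rw [dslope_same, hE.deriv] at h
    exact h.comp hC
  have h := ((hS'.mul hD).mul ((tendsto_cos_sub_one_div_sq.sub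
    tendsto_sin_div_sub_one_div_sq).mul hS')).sub
      ((tendsto_sin_div_sub_one_div_sq.mul hS').mul_const (exp (-1)))
  have hlim : 1 * -exp (-1) * ((-(1 / 2) - -(1 / 6)) * 1) - -(1 / 6) * 1 * exp (-1) =
      1 / (2 * exp 1) := by
    rw [exp_neg]
    field_simp
    norm_num
  rw [hlim] at h
  refine h.congr' ?_
  filter_upwards [hpos] with θ hθ
  have hθ0 := hθ.1.ne'
  have hs0 := hθ.2.ne'
  have hd := sub_smul_dslope (fun c => exp (-c)) 1 (cos θ * (sin θ / θ)⁻¹)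
  simp only [smul_eq_mul] at hd
  have hFe : delayOfPhase θ = (sin θ / θ)⁻¹ * exp (-(cos θ * (sin θ / θ)⁻¹)) := by
    rw [delayOfPhase, inv_div]
    congr 3
    ring
  have hF2 : delayOfPhase θ - 1 / exp 1 = (sin θ / θ)⁻¹ *
      ((cos θ * (sin θ / θ)⁻¹ - 1) * dslope (fun c => exp (-c)) 1 (cos θ * (sin θ / θ)⁻¹)) +
        ((sin θ / θ)⁻¹ - 1) * exp (-1) := by
    rw [hd, hFe, exp_neg 1]
    ring
  rw [hF2]
  generalize dslope (fun c => exp (-c)) 1 (cos θ * (sin θ / θ)⁻¹) = d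
  field_simp
  ring

theorem tendsto_delayOfPhase :
    Tendsto delayOfPhase (nhdsWithin 0 (Ioi 0)) (nhds (1 / exp 1)) := by
  have hsq : Tendsto (fun θ : ℝ => θ ^ 2) (nhdsWithin 0 (Ioi 0)) (nhds 0) :=
    tendsto_nhdsWithin_of_tendsto_nhds (by simpa using (continuous_pow 2).tendsto (0 : ℝ))
  have h := (tendsto_delayOfPhase_sub_div_sq.mul hsq).add_const (1 / exp 1)
  rw [mul_zero, zero_add] at h
  refine h.congr' ?_
  filter_upwards [self_mem_nhdsWithin] with θ hθ
  have : θ ≠ 0 := ne_of_gt hθ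
  rw [div_mul_cancel₀ _ (by positivity), sub_add_cancel]

theorem eventually_lt_delayOfPhase :
    ∀ᶠ θ in nhdsWithin 0 (Ioi 0), 1 / exp 1 < delayOfPhase θ := by
  have h : (0 : ℝ) < 1 / (2 * exp 1) := by positivity
  filter_upwards [tendsto_delayOfPhase_sub_div_sq.eventually (lt_mem_nhds h),
    self_mem_nhdsWithin] with θ h1 hθ
  have h2 : (0 : ℝ) < θ ^ 2 := pow_pos hθ 2
  linarith [(div_pos_iff_of_pos_right h2).1 h1]

theorem continuousOn_delayOfPhase : ContinuousOn delayOfPhase (Ioo 0 π) := by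
  have hs : ∀ θ ∈ Ioo 0 π, sin θ ≠ 0 := fun θ hθ => (sin_pos_of_pos_of_lt_pi hθ.1 hθ.2).ne'
  unfold delayOfPhase
  fun_prop (disch := assumption)

/-- Every delay slightly above `1/e` is the delay of a small phase. -/
theorem nhdsWithin_le_map_delayOfPhase :
    nhdsWithin (1 / exp 1) (Ioi (1 / exp 1)) ≤ map delayOfPhase (nhdsWithin 0 (Ioi 0)) := by
  intro s hs
  obtain ⟨δ, hδ, hsub⟩ := mem_nhdsGT_iff_exists_Ioo_subset.1
    (inter_mem (mem_map.1 hs) (inter_mem eventually_lt_delayOfPhase (Ioo_mem_nhdsGT pi_pos)))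
  rw [mem_Ioi] at hδ
  have hmid : δ / 2 ∈ Ioo 0 δ := ⟨by linarith, by linarith⟩
  filter_upwards [Ioo_mem_nhdsGT (hsub hmid).2.1] with τ hτ
  obtain ⟨η, hητ, hη⟩ := ((tendsto_delayOfPhase.eventually (gt_mem_nhds hτ.1)).and
    (Ioo_mem_nhdsGT hmid.1)).exists
  have hIcc : Icc η (δ / 2) ⊆ Ioo 0 δ := fun r hr =>
    ⟨hη.1.trans_le hr.1, hr.2.trans_lt hmid.2⟩
  obtain ⟨θ, hθ, rfl⟩ := intermediate_value_Icc hη.2.le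
    (continuousOn_delayOfPhase.mono fun r hr => (hsub (hIcc hr)).2.2) ⟨hητ.le, hτ.2.le⟩
  exact (hsub (hIcc hθ)).1

theorem tendsto_pi_div_mul_sqrt :
    Tendsto (fun θ => π / (θ / delayOfPhase θ) * √(delayOfPhase θ - 1 / exp 1))
      (nhdsWithin 0 (Ioi 0)) (nhds (π / √(2 * exp 1 ^ 3))) := by
  have h := (tendsto_delayOfPhase.const_mul π).mul tendsto_delayOfPhase_sub_div_sq.sqrt
  have hlim : π * (1 / exp 1) * √(1 / (2 * exp 1)) = π / √(2 * exp 1 ^ 3) := by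
    have he := exp_pos 1
    have e : 2 * exp 1 ^ 3 = (exp 1) ^ 2 * (2 * exp 1) := by ring
    rw [e, sqrt_mul (by positivity), sqrt_sq he.le, sqrt_div zero_le_one, sqrt_one]
    field_simp
  rw [hlim] at h
  refine h.congr' ?_
  filter_upwards [self_mem_nhdsWithin] with θ hθ
  rw [mem_Ioi] at hθ
  rw [sqrt_div' _ (sq_nonneg θ), sqrt_sq hθ.le, div_div_eq_mul_div]
  ring

theorem stmt1
    (X : ℝ → ℝ → ℝ) (hX : ∀ τ > 1 / Real.exp 1, IsXSol τ (X τ))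
    (ϱ : ℝ → ℝ) (hϱ : ∀ τ, ϱ τ = firstRoot (X τ)) :
    Filter.Tendsto (fun τ => ϱ τ * Real.sqrt (τ - 1 / Real.exp 1))
      (nhdsWithin (1 / Real.exp 1) (Ioi (1 / Real.exp 1)))
      (nhds (Real.pi / Real.sqrt (2 * Real.exp 1 ^ 3))) := by
  refine Tendsto.mono_left ?_ nhdsWithin_le_map_delayOfPhase
  rw [tendsto_map'_iff]
  have hsqrt : Tendsto (fun θ => delayOfPhase θ * √(delayOfPhase θ - 1 / exp 1))
      (nhdsWithin 0 (Ioi 0)) (nhds 0) := by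
    simpa using tendsto_delayOfPhase.mul (tendsto_delayOfPhase.sub_const (1 / exp 1)).sqrt
  have hlo := tendsto_pi_div_mul_sqrt.sub (hsqrt.const_mul 2)
  have hhi := tendsto_pi_div_mul_sqrt.add hsqrt
  rw [mul_zero, sub_zero] at hlo
  rw [add_zero] at hhi
  have hmem : ∀ᶠ θ in nhdsWithin 0 (Ioi 0),
      ϱ (delayOfPhase θ) ∈ Icc (π / (θ / delayOfPhase θ) - 2 * delayOfPhase θ)
        (π / (θ / delayOfPhase θ) + delayOfPhase θ) := by
    filter_upwards [eventually_lt_delayOfPhase, Ioo_mem_nhdsGT pi_div_two_pos] with θ h1 hθ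
    rw [hϱ]
    exact (hX _ h1).firstRoot_mem_Icc hθ.1 hθ.2
  refine tendsto_of_tendsto_of_tendsto_of_le_of_le' hlo hhi ?_ ?_
  · filter_upwards [hmem] with θ h
    have := mul_le_mul_of_nonneg_right h.1 (sqrt_nonneg (delayOfPhase θ - 1 / exp 1))
    simp only [Function.comp_apply]
    linarith
  · filter_upwards [hmem] with θ h
    have := mul_le_mul_of_nonneg_right h.2 (sqrt_nonneg (delayOfPhase θ - 1 / exp 1))
    simp only [Function.comp_apply]
    linarith
end
end

section
/- The function Λ : (1/e, 2] → ℝ is continuous and strictly decreasing. -/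
open Real MeasureTheory Filter Set

noncomputable section

theorem hasDerivAt_integral_of_continuous {f : ℝ → ℝ} (hf : Continuous f) (a t : ℝ) :
    HasDerivAt (fun t => ∫ s in a..t, f s) (f t) t :=
  intervalIntegral.integral_hasDerivAt_right (hf.intervalIntegrable _ _)
    (hf.stronglyMeasurableAtFilter _ _) hf.continuousAt

namespace IsXSol

variable {τ : ℝ} {x : ℝ → ℝ}

theorem hasDerivAt_s6 (h : IsXSol τ x) {t : ℝ} (ht : 0 < t) : HasDerivAt x (-x (t - τ)) t := by
  have hc : Continuous fun s => x (s - τ) := h.1.comp (by fun_prop)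
  have h1 : HasDerivAt (fun t => 1 - ∫ s in (0:ℝ)..t, x (s - τ)) (-x (t - τ)) t :=
    (hasDerivAt_integral_of_continuous hc 0 t).const_sub 1
  refine h1.congr_of_eventuallyEq ?_
  filter_upwards [lt_mem_nhds ht] with s hs using h.2.2 s hs.le

theorem apply_zero (h : IsXSol τ x) : x 0 = 1 := h.2.1 0 le_rfl

theorem sub_eq (h : IsXSol τ x) {s t : ℝ} (hs : 0 ≤ s) (ht : 0 ≤ t) :
    x s - x t = ∫ u in s..t, x (u - τ) := by
  have hc : Continuous fun s => x (s - τ) := h.1.comp (by fun_prop)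
  rw [h.2.2 s hs, h.2.2 t ht, ← intervalIntegral.integral_interval_sub_left
    (hc.intervalIntegrable 0 t) (hc.intervalIntegrable 0 s)]
  ring

/-- If `x` is positive before `b`, it is nonincreasing up to `b + τ`. -/
theorem antitoneOn_of_pos (h : IsXSol τ x) {b : ℝ} (hb : 0 ≤ b + τ)
    (hpos : ∀ t < b, 0 < x t) : AntitoneOn x (Iic (b + τ)) := by
  have h1 : AntitoneOn x (Icc 0 (b + τ)) := by
    apply antitoneOn_of_deriv_nonpos (convex_Icc _ _) h.1.continuousOn
    · intro t ht
      rw [interior_Icc] at ht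
      exact (h.hasDerivAt_s6 ht.1).differentiableAt.differentiableWithinAt
    · intro t ht
      rw [interior_Icc] at ht
      rw [(h.hasDerivAt_s6 ht.1).deriv]
      linarith [hpos (t - τ) (by linarith [ht.2])]
  intro s hs t ht hst
  rw [mem_Iic] at hs ht
  rcases le_total t 0 with ht0 | ht0
  · rw [h.2.1 t ht0, h.2.1 s (hst.trans ht0)]
  rcases le_total s 0 with hs0 | hs0
  · rw [h.2.1 s hs0, ← h.apply_zero]
    exact h1 ⟨le_rfl, hb⟩ ⟨ht0, ht⟩ ht0
  · exact h1 ⟨hs0, hs⟩ ⟨ht0, ht⟩ hst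

theorem strictAntiOn_of_pos (h : IsXSol τ x) {b : ℝ}
    (hpos : ∀ t < b, 0 < x t) : StrictAntiOn x (Icc 0 (b + τ)) := by
  apply strictAntiOn_of_deriv_neg (convex_Icc _ _) h.1.continuousOn
  intro t ht
  rw [interior_Icc] at ht
  rw [(h.hasDerivAt_s6 ht.1).deriv]
  linarith [hpos (t - τ) (by linarith [ht.2])]

theorem pos_of_ne_zero (h : IsXSol τ x) {b : ℝ} (hb : ∀ t, 0 < t → t < b → x t ≠ 0) :
    ∀ t < b, 0 < x t := by
  intro t ht
  rcases le_or_gt t 0 with h0 | h0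
  · rw [h.2.1 t h0]; exact one_pos
  by_contra! hneg
  obtain ⟨s, hs, hs0⟩ := intermediate_value_Icc' h0.le h.1.continuousOn
    ⟨hneg, by rw [h.apply_zero]; exact zero_le_one⟩
  rcases hs.1.eq_or_lt with rfl | hs1
  · rw [h.apply_zero] at hs0; exact one_ne_zero hs0
  · exact hb s hs1 (hs.2.trans_lt ht) hs0

theorem exp_mul_le_delayed (h : IsXSol τ x) (hτ : 0 < τ) {c T : ℝ} (hT : 0 ≤ T)
    (hc : ∀ t ≥ T, c * x t ≤ x (t - τ)) :
    ∀ t ≥ T + τ, exp (c * τ) * x t ≤ x (t - τ) := by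
  have hd : ∀ t, 0 < t → HasDerivAt (fun t => x t * exp (c * t))
      (-x (t - τ) * exp (c * t) + x t * (exp (c * t) * (c * 1))) t := fun t ht =>
    (h.hasDerivAt_s6 ht).mul (((hasDerivAt_id t).const_mul c).exp)
  have hanti : AntitoneOn (fun t => x t * exp (c * t)) (Ici T) := by
    apply antitoneOn_of_deriv_nonpos (convex_Ici _)
    · exact (h.1.mul (by fun_prop)).continuousOn
    · intro t ht
      rw [interior_Ici] at ht
      exact (hd t (hT.trans_lt ht)).differentiableAt.differentiableWithinAt
    · intro t ht
      rw [interior_Ici] at ht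
      rw [(hd t (hT.trans_lt ht)).deriv]
      nlinarith [hc t (le_of_lt ht), exp_pos (c * t)]
  intro t ht
  have h1 := hanti (a := t - τ) (b := t) (by simp only [mem_Ici]; linarith)
    (by simp only [mem_Ici]; linarith) (by linarith)
  have h2 : exp (c * t) = exp (c * (t - τ)) * exp (c * τ) := by rw [← exp_add]; ring_nf
  simp only [h2] at h1
  have h3 := exp_pos (c * (t - τ))
  by_contra! hlt
  nlinarith [mul_lt_mul_of_pos_left hlt h3]

/-- For `τ > 1/e` the solution has a positive root. -/
theorem exists_root_s6 (h : IsXSol τ x) (hτ : 1 / exp 1 < τ) : ∃ t, 0 < t ∧ x t = 0 := by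
  by_contra! hne
  have hτ0 : 0 < τ := lt_trans (by positivity) hτ
  have hpos : ∀ t, 0 < x t := fun t =>
    h.pos_of_ne_zero (b := t + 1) (fun s hs _ => hne s hs) t (by linarith)
  have hanti : Antitone x := fun s t hst =>
    h.antitoneOn_of_pos (b := max t 0) (by positivity) (fun t _ => hpos t)
      (by simp only [mem_Iic]; linarith [le_max_left t 0])
      (by simp only [mem_Iic]; linarith [le_max_left t 0]) hst
  have hhalf : ∀ t, 0 ≤ t → τ / 2 * x (t - τ / 2) ≤ x t := by
    intro t ht
    have h1 := h.sub_eq ht (t := t + τ / 2) (by linarith)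
    have h2 : ∫ u in t..(t + τ / 2), x (t - τ / 2) ≤ ∫ u in t..(t + τ / 2), x (u - τ) := by
      apply intervalIntegral.integral_mono_on (by linarith) (by simp)
      · exact (h.1.comp (by fun_prop : Continuous fun u => u - τ)).intervalIntegrable _ _
      · intro u hu
        exact hanti (by linarith [hu.2])
    rw [intervalIntegral.integral_const, smul_eq_mul] at h2
    nlinarith [hpos (t + τ / 2)]
  have hratio : ∀ t ≥ τ, (τ / 2) ^ 2 * x (t - τ) ≤ x t := by
    intro t ht
    have h1 := hhalf t (by linarith)
    have h2 := hhalf (t - τ / 2) (by linarith)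
    rw [show t - τ / 2 - τ / 2 = t - τ by ring] at h2
    nlinarith
  have hgrow : ∀ n : ℕ, ∀ t ≥ (n : ℝ) * τ, (exp 1 * τ) ^ n * x t ≤ x (t - τ) := by
    intro n
    induction n with
    | zero => intro t _; simpa using hanti (by linarith : t - τ ≤ t)
    | succ n ih =>
      intro t ht
      push_cast at ht
      have h1 := h.exp_mul_le_delayed hτ0 (by positivity) ih t (by linarith)
      refine le_trans (mul_le_mul_of_nonneg_right ?_ (hpos t).le) h1
      have h2 := add_one_le_exp ((exp 1 * τ) ^ n * τ - 1)
      have h3 : exp ((exp 1 * τ) ^ n * τ) = exp 1 * exp ((exp 1 * τ) ^ n * τ - 1) := by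
        rw [← exp_add]; ring_nf
      rw [h3, pow_succ]
      nlinarith [exp_pos 1]
  have h1 : 1 < exp 1 * τ := by
    rw [div_lt_iff₀ (exp_pos 1)] at hτ; linarith
  obtain ⟨n, hn⟩ := pow_unbounded_of_one_lt (1 / (τ / 2) ^ 2) h1
  rw [div_lt_iff₀ (by positivity)] at hn
  set t : ℝ := max (n * τ) τ
  have h2 := hgrow n t (le_max_left _ _)
  have h3 := hratio t (le_max_right _ _)
  nlinarith [hpos t, mul_le_mul_of_nonneg_left h2 (by positivity : 0 ≤ (τ / 2) ^ 2)]

theorem isLeast_firstRoot (h : IsXSol τ x) (hτ : 1 / exp 1 < τ) :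
    IsLeast {t : ℝ | 0 < t ∧ x t = 0} (firstRoot x) := by
  have hset : {t : ℝ | 0 < t ∧ x t = 0} = {t : ℝ | 0 ≤ t ∧ x t = 0} := by
    ext t
    refine ⟨fun ht => ⟨ht.1.le, ht.2⟩, fun ht => ⟨ht.1.lt_of_ne ?_, ht.2⟩⟩
    rintro rfl
    exact one_ne_zero (h.apply_zero.symm.trans ht.2)
  have hclosed : IsClosed {t : ℝ | 0 < t ∧ x t = 0} := by
    rw [hset]
    exact isClosed_Ici.inter (isClosed_eq h.1 continuous_const)
  exact hclosed.isLeast_csInf (h.exists_root_s6 hτ) ⟨0, fun _ ht => ht.1.le⟩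

theorem pos_of_lt_firstRoot (h : IsXSol τ x) (hτ : 1 / exp 1 < τ) :
    ∀ t < firstRoot x, 0 < x t :=
  h.pos_of_ne_zero fun _ ht htb h0 =>
    not_le_of_gt htb ((h.isLeast_firstRoot hτ).2 ⟨ht, h0⟩)

theorem antitoneOn (h : IsXSol τ x) (hτ : 1 / exp 1 < τ) :
    AntitoneOn x (Iic (firstRoot x + τ)) :=
  h.antitoneOn_of_pos
    (add_nonneg (h.isLeast_firstRoot hτ).1.1.le (lt_trans (by positivity) hτ).le)
    (h.pos_of_lt_firstRoot hτ)

theorem strictAntiOn (h : IsXSol τ x) (hτ : 1 / exp 1 < τ) :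
    StrictAntiOn x (Icc 0 (firstRoot x + τ)) :=
  h.strictAntiOn_of_pos (h.pos_of_lt_firstRoot hτ)

theorem nonneg_of_le_firstRoot (h : IsXSol τ x) (hτ : 1 / exp 1 < τ) {t : ℝ}
    (ht : t ≤ firstRoot x) : 0 ≤ x t := by
  rcases ht.eq_or_lt with rfl | ht
  · exact (h.isLeast_firstRoot hτ).1.2.ge
  · exact (h.pos_of_lt_firstRoot hτ t ht).le

theorem le_one (h : IsXSol τ x) (hτ : 1 / exp 1 < τ) {t : ℝ} (ht : t ≤ firstRoot x + τ) :
    x t ≤ 1 := by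
  rcases le_total t 0 with h0 | h0
  · exact (h.2.1 t h0).le
  · rw [← h.apply_zero]
    exact h.antitoneOn hτ (h0.trans ht) ht h0

theorem sub_le_sub (h : IsXSol τ x) (hτ : 1 / exp 1 < τ) {s t : ℝ} (hst : s ≤ t)
    (ht : t ≤ firstRoot x + τ) : x s - x t ≤ t - s := by
  have hτ0 : 0 < τ := lt_trans (by positivity) hτ
  have key : ∀ s, 0 ≤ s → s ≤ t → x s - x t ≤ t - s := by
    intro s hs hst
    rw [h.sub_eq hs (hs.trans hst)]
    have h2 : ∫ u in s..t, x (u - τ) ≤ ∫ u in s..t, (1 : ℝ) := by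
      apply intervalIntegral.integral_mono_on hst
      · exact (h.1.comp (by fun_prop : Continuous fun u => u - τ)).intervalIntegrable _ _
      · simp
      · intro u hu
        exact h.le_one hτ (by linarith [hu.2])
    simpa using h2
  rcases le_total t 0 with ht0 | ht0
  · rw [h.2.1 t ht0, h.2.1 s (hst.trans ht0)]; linarith
  rcases le_total s 0 with hs0 | hs0
  · have := key 0 le_rfl ht0
    rw [h.apply_zero] at this
    rw [h.2.1 s hs0]; linarith
  · exact key s hs0 hst

theorem abs_apply_sub_apply_le (h : IsXSol τ x) (hτ : 1 / exp 1 < τ) {s t : ℝ}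
    (hs : s ≤ firstRoot x + τ) (ht : t ≤ firstRoot x + τ) : |x s - x t| ≤ |s - t| := by
  wlog hst : s ≤ t generalizing s t
  · rw [abs_sub_comm, abs_sub_comm s]
    exact this ht hs (le_of_not_ge hst)
  rw [abs_of_nonneg (sub_nonneg.2 (h.antitoneOn hτ hs ht hst)), abs_sub_comm,
    abs_of_nonneg (sub_nonneg.2 hst)]
  exact h.sub_le_sub hτ hst ht

theorem one_le_firstRoot (h : IsXSol τ x) (hτ : 1 / exp 1 < τ) : 1 ≤ firstRoot x := by
  have hτ0 : 0 < τ := lt_trans (by positivity) hτ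
  obtain ⟨⟨h0, h1⟩, _⟩ := h.isLeast_firstRoot hτ
  have := h.sub_le_sub hτ h0.le (by linarith)
  rw [h1, h.apply_zero] at this
  linarith

end IsXSol

namespace IsXSol

variable {τ₁ τ₂ : ℝ} {x₁ x₂ : ℝ → ℝ}

/-- Looking back from a common value, the solution with the larger delay is the larger one. -/
theorem apply_sub_le_apply_sub_of_eq (h₁ : IsXSol τ₁ x₁) (h₂ : IsXSol τ₂ x₂)
    (hτ₁ : 1 / exp 1 < τ₁) (hτ : τ₁ < τ₂) (n : ℕ) :
    ∀ t, 0 ≤ t → t ≤ firstRoot x₂ → t ≤ n * (τ₂ - τ₁) →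
      ∀ r, 0 ≤ r → r ≤ firstRoot x₁ → x₁ r = x₂ t →
        ∀ u, 0 ≤ u → x₁ (r - u) ≤ x₂ (t - u) := by
  have hτ₂ := hτ₁.trans hτ
  have hτ0 : 0 < τ₁ := lt_trans (by positivity) hτ₁
  have hδ : 0 < τ₂ - τ₁ := sub_pos.2 hτ
  have hs₁ := h₁.strictAntiOn hτ₁
  have hs₂ := h₂.strictAntiOn hτ₂
  have ha₁ := h₁.antitoneOn hτ₁
  have ha₂ := h₂.antitoneOn hτ₂
  have hϱ₁ := (h₁.isLeast_firstRoot hτ₁).1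
  have hϱ₂ := (h₂.isLeast_firstRoot hτ₂).1
  induction n with
  | zero =>
    intro t ht0 _ htn r hr0 hr1 _ u hu
    obtain rfl : t = 0 := le_antisymm (by simpa using htn) ht0
    rw [h₂.2.1 (0 - u) (by linarith)]
    exact h₁.le_one hτ₁ (by linarith)
  | succ n ih =>
    intro t ht0 ht1 htn r hr0 hr1 hrt u hu
    rcases le_total t (n * (τ₂ - τ₁)) with hle | hge
    · exact ih t ht0 ht1 hle r hr0 hr1 hrt u hu
    set T : ℝ := n * (τ₂ - τ₁)
    have hT0 : 0 ≤ T := by positivity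
    have htT : t ≤ T + (τ₂ - τ₁) := by push_cast at htn; linarith
    obtain ⟨r₀, hr₀, hr₀T⟩ := intermediate_value_Icc' hϱ₁.1.le h₁.1.continuousOn
      (show x₂ T ∈ Icc (x₁ (firstRoot x₁)) (x₁ 0) by
        rw [hϱ₁.2, h₁.apply_zero]
        exact ⟨h₂.nonneg_of_le_firstRoot hτ₂ (hge.trans ht1), h₂.le_one hτ₂ (by linarith)⟩)
    have hT1 := ih T hT0 (hge.trans ht1) le_rfl r₀ hr₀.1 hr₀.2 hr₀T
    have hr₀r : r₀ ≤ r := by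
      rw [← hs₁.le_iff_ge ⟨hr0, by linarith⟩ ⟨hr₀.1, by linarith [hr₀.2]⟩, hrt, hr₀T]
      exact ha₂ (by simp only [mem_Iic]; linarith) (by simp only [mem_Iic]; linarith) hge
    have hback : ∀ u, 0 ≤ u → u ≤ r - r₀ → u ≤ t - T → x₁ (r - u) ≤ x₂ (t - u) := by
      intro u hu hur hut
      have e₁ := h₁.sub_eq (s := r - u) (t := r) (by linarith [hr₀.1]) hr0
      have e₂ := h₂.sub_eq (s := t - u) (t := t) (by linarith) ht0
      have hi₁ : ∫ v in (r - u)..r, x₁ (v - τ₁) ≤ ∫ v in (r - u)..r, x₁ (r₀ - τ₁) := by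
        apply intervalIntegral.integral_mono_on (by linarith)
        · exact (h₁.1.comp (by fun_prop : Continuous fun v => v - τ₁)).intervalIntegrable _ _
        · simp
        · intro v hv
          exact ha₁ (by simp only [mem_Iic]; linarith [hr₀.2])
            (by simp only [mem_Iic]; linarith [hv.2]) (by linarith [hv.1])
      have hi₂ : ∫ v in (t - u)..t, x₂ (T - τ₁) ≤ ∫ v in (t - u)..t, x₂ (v - τ₂) := by
        apply intervalIntegral.integral_mono_on (by linarith)
        · simp
        · exact (h₂.1.comp (by fun_prop : Continuous fun v => v - τ₂)).intervalIntegrable _ _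
        · intro v hv
          exact ha₂ (by simp only [mem_Iic]; linarith [hv.2])
            (by simp only [mem_Iic]; linarith) (by linarith [hv.2])
      rw [intervalIntegral.integral_const, smul_eq_mul] at hi₁ hi₂
      have := mul_le_mul_of_nonneg_left (hT1 τ₁ hτ0.le) hu
      nlinarith
    have hlen : t - T ≤ r - r₀ := by
      by_contra! hlt
      have h1 := hback (r - r₀) (by linarith) le_rfl hlt.le
      rw [sub_sub_cancel, hr₀T] at h1
      have h2 := hs₂ (a := T) (b := t - (r - r₀)) ⟨hT0, by linarith⟩
        ⟨by linarith, by linarith⟩ (by linarith)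
      linarith
    rcases le_total u (t - T) with hu1 | hu1
    · exact hback u hu (hu1.trans hlen) hu1
    · have h1 := hT1 (u - (t - T)) (by linarith)
      rw [show T - (u - (t - T)) = t - u by ring] at h1
      refine le_trans (ha₁ ?_ ?_ ?_) h1
      · simp only [mem_Iic]; linarith [hr₀.2]
      · simp only [mem_Iic]; linarith
      · linarith

theorem apply_firstRoot_sub_le (h₁ : IsXSol τ₁ x₁) (h₂ : IsXSol τ₂ x₂)
    (hτ₁ : 1 / exp 1 < τ₁) (hτ : τ₁ < τ₂) {u : ℝ} (hu : 0 ≤ u) :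
    x₁ (firstRoot x₁ - u) ≤ x₂ (firstRoot x₂ - u) := by
  have hϱ₁ := (h₁.isLeast_firstRoot hτ₁).1
  have hϱ₂ := (h₂.isLeast_firstRoot (hτ₁.trans hτ)).1
  obtain ⟨n, hn⟩ := exists_nat_ge (firstRoot x₂ / (τ₂ - τ₁))
  rw [div_le_iff₀ (sub_pos.2 hτ)] at hn
  exact h₁.apply_sub_le_apply_sub_of_eq h₂ hτ₁ hτ n _ hϱ₂.1.le le_rfl hn _ hϱ₁.1.le le_rfl
    (hϱ₁.2.trans hϱ₂.2.symm) u hu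

theorem firstRoot_le_firstRoot (h₁ : IsXSol τ₁ x₁) (h₂ : IsXSol τ₂ x₂)
    (hτ₁ : 1 / exp 1 < τ₁) (hτ : τ₁ < τ₂) : firstRoot x₂ ≤ firstRoot x₁ := by
  have hτ₂ := hτ₁.trans hτ
  have hτ0 : 0 < τ₂ := lt_trans (by positivity) hτ₂
  have hϱ₁ := (h₁.isLeast_firstRoot hτ₁).1
  by_contra! hlt
  have h1 := h₁.apply_firstRoot_sub_le h₂ hτ₁ hτ hϱ₁.1.le
  rw [sub_self, h₁.apply_zero] at h1
  have h2 := h₂.strictAntiOn hτ₂ (a := 0) (b := firstRoot x₂ - firstRoot x₁)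
    ⟨le_rfl, by linarith [hϱ₁.1]⟩ ⟨by linarith, by linarith [hϱ₁.1]⟩ (by linarith)
  rw [h₂.apply_zero] at h2
  linarith

/-- Lipschitz dependence of the solution on the delay, up to time `firstRoot x₁ + τ₁`. -/
theorem exists_abs_sub_le_mul (h₁ : IsXSol τ₁ x₁) (hτ₁ : 1 / exp 1 < τ₁) :
    ∃ C : ℝ, 0 ≤ C ∧ ∀ τ x, 1 / exp 1 < τ → IsXSol τ x →
      ∀ t ≤ firstRoot x₁ + τ₁, |x t - x₁ t| ≤ C * |τ - τ₁| := by
  have hτ0 : 0 < τ₁ := lt_trans (by positivity) hτ₁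
  have hϱ := (h₁.isLeast_firstRoot hτ₁).1.1
  set b := firstRoot x₁ + τ₁
  have hb0 : 0 < b := by positivity
  have steps : ∀ n : ℕ, ∃ C : ℝ, 0 ≤ C ∧ ∀ τ x, 1 / exp 1 < τ → IsXSol τ x →
      ∀ t ≤ b, t ≤ n * (1 / exp 1) → |x t - x₁ t| ≤ C * |τ - τ₁| := by
    intro n
    induction n with
    | zero =>
      refine ⟨0, le_rfl, fun τ x _ hx t _ ht => ?_⟩
      have ht : t ≤ 0 := by simpa using ht
      rw [hx.2.1 t ht, h₁.2.1 t ht]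
      simp
    | succ n ih =>
      obtain ⟨C, hC, ih⟩ := ih
      refine ⟨(C + 1) * b, by positivity, fun τ x hτ hx t htb ht => ?_⟩
      have hτ' : 0 < τ := lt_trans (by positivity) hτ
      rcases le_total t 0 with ht0 | ht0
      · rw [hx.2.1 t ht0, h₁.2.1 t ht0, sub_self, abs_zero]
        positivity
      have hc : Continuous fun s => x (s - τ) := hx.1.comp (by fun_prop)
      have hc₁ : Continuous fun s => x₁ (s - τ₁) := h₁.1.comp (by fun_prop)
      have heq : x t - x₁ t = ∫ s in (0:ℝ)..t, (x₁ (s - τ₁) - x (s - τ)) := by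
        rw [intervalIntegral.integral_sub (hc₁.intervalIntegrable _ _)
          (hc.intervalIntegrable _ _), hx.2.2 t ht0, h₁.2.2 t ht0]
        ring
      rw [heq, ← Real.norm_eq_abs]
      have hbound : ∀ s ∈ uIoc 0 t, ‖x₁ (s - τ₁) - x (s - τ)‖ ≤ (C + 1) * |τ - τ₁| := by
        intro s hs
        rw [uIoc_of_le ht0] at hs
        push_cast at ht
        have e₁ := ih τ x hτ hx (s - τ) (by linarith [hs.2]) (by linarith [hs.2])
        have e₂ := h₁.abs_apply_sub_apply_le hτ₁ (s := s - τ₁) (t := s - τ) (by linarith [hs.2])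
          (by linarith [hs.2])
        rw [show s - τ₁ - (s - τ) = τ - τ₁ by ring] at e₂
        rw [abs_sub_comm] at e₁
        rw [Real.norm_eq_abs]
        have e₃ := abs_sub_le (x₁ (s - τ₁)) (x₁ (s - τ)) (x (s - τ))
        linarith
      refine (intervalIntegral.norm_integral_le_of_norm_le_const hbound).trans ?_
      rw [sub_zero, abs_of_nonneg ht0]
      nlinarith [mul_le_mul_of_nonneg_left htb
        (by positivity : 0 ≤ (C + 1) * |τ - τ₁|)]
  obtain ⟨n, hn⟩ := exists_nat_ge (b / (1 / exp 1))
  rw [div_le_iff₀ (by positivity)] at hn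
  obtain ⟨C, hC, h⟩ := steps n
  exact ⟨C, hC, fun τ x hτ hx t ht => h τ x hτ hx t ht (ht.trans hn)⟩

end IsXSol

/-- `φ` solves `φ' = max F φ` on `[0,∞)` with `φ 0 = 0`. -/
def IsMaxSol (F φ : ℝ → ℝ) : Prop :=
  φ 0 = 0 ∧ ∀ t ≥ (0:ℝ), HasDerivAt φ (max (F t) (φ t)) t

namespace IsMaxSol

variable {F F₁ F₂ φ φ₁ φ₂ : ℝ → ℝ}

theorem continuousOn (h : IsMaxSol F φ) : ContinuousOn φ (Ici 0) :=
  fun t ht => (h.2 t ht).continuousAt.continuousWithinAt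

theorem monotoneOn (h : IsMaxSol F φ) (hF : ∀ s ≥ 0, 0 ≤ F s) : MonotoneOn φ (Ici 0) := by
  apply monotoneOn_of_deriv_nonneg (convex_Ici 0) h.continuousOn
  · intro t ht
    exact (h.2 t (interior_subset ht)).differentiableAt.differentiableWithinAt
  · intro t ht
    have ht := interior_subset ht
    rw [(h.2 t ht).deriv]
    exact (hF t ht).trans (le_max_left _ _)

theorem strictMonoOn (h : IsMaxSol F φ) (hF : ∀ s ≥ 0, 0 ≤ F s) {τ : ℝ} (hτ : 0 < τ)
    (hpos : ∀ s < τ, 0 < F s) : StrictMonoOn φ (Ici 0) := by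
  have h1 : StrictMonoOn φ (Icc 0 τ) := by
    apply strictMonoOn_of_deriv_pos (convex_Icc 0 τ) (h.continuousOn.mono Icc_subset_Ici_self)
    intro t ht
    rw [interior_Icc] at ht
    rw [(h.2 t ht.1.le).deriv]
    exact (hpos t ht.2).trans_le (le_max_left _ _)
  have hφτ : 0 < φ τ := h.1 ▸ h1 (left_mem_Icc.2 hτ.le) (right_mem_Icc.2 hτ.le) hτ
  apply strictMonoOn_of_deriv_pos (convex_Ici 0) h.continuousOn
  intro t ht
  have ht : 0 ≤ t := interior_subset ht
  rw [(h.2 t ht).deriv]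
  rcases lt_or_ge t τ with htτ | htτ
  · exact (hpos t htτ).trans_le (le_max_left _ _)
  · exact (hφτ.trans_le (h.monotoneOn hF hτ.le ht htτ)).trans_le (le_max_right _ _)

theorem le_add_mul_exp (h₁ : IsMaxSol F₁ φ₁) (h₂ : IsMaxSol F₂ φ₂) {ε : ℝ} (hε : 0 < ε)
    (hF : ∀ s ≥ 0, F₁ s ≤ F₂ s + ε) {t : ℝ} (ht : 0 ≤ t) :
    φ₁ t ≤ φ₂ t + ε * exp (2 * t) := by
  have hB : ∀ s ≥ 0, HasDerivAt (fun s => φ₂ s + ε * exp (2 * s))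
      (max (F₂ s) (φ₂ s) + ε * (exp (2 * s) * (2 * 1))) s := fun s hs =>
    (h₂.2 s hs).add ((((hasDerivAt_id s).const_mul 2).exp).const_mul ε)
  refine image_le_of_deriv_right_lt_deriv_boundary' (a := 0) (b := t)
    (h₁.continuousOn.mono Icc_subset_Ici_self)
    (fun s hs => (h₁.2 s hs.1).hasDerivWithinAt) ?_
    (fun s hs => (hB s hs.1).continuousAt.continuousWithinAt)
    (fun s hs => (hB s hs.1).hasDerivWithinAt) ?_ ⟨ht, le_rfl⟩
  · simp only [h₁.1, h₂.1]; positivity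
  · intro s hs heq
    have h1 : 1 ≤ exp (2 * s) := one_le_exp (by linarith [hs.1])
    have h2 : ε ≤ ε * exp (2 * s) := by nlinarith
    have h3 := le_max_left (F₂ s) (φ₂ s)
    have h4 := le_max_right (F₂ s) (φ₂ s)
    rw [max_lt_iff]
    exact ⟨by linarith [hF s hs.1], by linarith⟩

theorem mono (h₁ : IsMaxSol F₁ φ₁) (h₂ : IsMaxSol F₂ φ₂) (hF : ∀ s ≥ 0, F₁ s ≤ F₂ s)
    {t : ℝ} (ht : 0 ≤ t) : φ₁ t ≤ φ₂ t := by
  refine le_of_forall_pos_le_add fun ε hε => ?_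
  have hpos := exp_pos (2 * t)
  have := h₁.le_add_mul_exp h₂ (div_pos hε hpos)
    (fun s hs => (hF s hs).trans (by linarith [div_pos hε hpos])) ht
  rwa [div_mul_cancel₀ _ hpos.ne'] at this

theorem lt_of_max_lt (h₁ : IsMaxSol F₁ φ₁) (h₂ : IsMaxSol F₂ φ₂)
    (hF : ∀ s ≥ 0, F₁ s ≤ F₂ s) {σ t : ℝ} (hσ : 0 < σ) (hσt : σ < t)
    (hlt : max (F₁ σ) (φ₁ σ) < F₂ σ) : φ₁ t < φ₂ t := by
  have hd : ∀ s ≥ 0, HasDerivAt (fun s => φ₂ s - φ₁ s)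
      (max (F₂ s) (φ₂ s) - max (F₁ s) (φ₁ s)) s := fun s hs => (h₂.2 s hs).sub (h₁.2 s hs)
  have hmono : MonotoneOn (fun s => φ₂ s - φ₁ s) (Ici 0) := by
    apply monotoneOn_of_deriv_nonneg (convex_Ici 0)
    · exact fun s hs => (hd s hs).continuousAt.continuousWithinAt
    · intro s hs
      exact (hd s (interior_subset hs)).differentiableAt.differentiableWithinAt
    · intro s hs
      have hs := interior_subset hs
      rw [(hd s hs).deriv]
      exact sub_nonneg.2 (max_le_max (hF s hs) (h₁.mono h₂ hF hs))
  by_contra! hle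
  have hzero : (fun s => φ₂ s - φ₁ s) =ᶠ[nhds σ] fun _ => 0 := by
    filter_upwards [Ioo_mem_nhds hσ hσt] with s hs
    have h1 := hmono (a := s) (b := t) hs.1.le (hσ.trans hσt).le hs.2.le
    have h2 := h₁.mono h₂ hF hs.1.le
    simp only at h1
    linarith
  have h1 := (hd σ hσ.le).unique ((hasDerivAt_const σ (0:ℝ)).congr_of_eventuallyEq hzero)
  linarith [le_max_left (F₂ σ) (φ₂ σ)]

theorem le_self (h : IsMaxSol F φ) (hF0 : ∀ s ≥ 0, 0 ≤ F s) (hF : ∀ s ≥ 0, F s ≤ 1) {t : ℝ}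
    (ht : 0 ≤ t) (hφ : φ t ≤ 1) : φ t ≤ t := by
  have hd : ∀ s ≥ 0, HasDerivAt (fun s => φ s - s) (max (F s) (φ s) - 1) s :=
    fun s hs => (h.2 s hs).sub (hasDerivAt_id s)
  have hanti : AntitoneOn (fun s => φ s - s) (Icc 0 t) := by
    apply antitoneOn_of_deriv_nonpos (convex_Icc 0 t)
    · exact fun s hs => (hd s hs.1).continuousAt.continuousWithinAt
    · intro s hs
      exact (hd s (interior_subset hs).1).differentiableAt.differentiableWithinAt
    · intro s hs
      have hs := interior_subset hs
      rw [(hd s hs.1).deriv, sub_nonpos]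
      exact max_le (hF s hs.1) ((h.monotoneOn hF0 hs.1 ht hs.2).trans hφ)
  have := hanti (left_mem_Icc.2 ht) (right_mem_Icc.2 ht) ht
  simp only [h.1] at this
  linarith

end IsMaxSol

/-- The forcing term of the equation for `ψ`, extended by `x ρ` beyond time `τ`. -/
def forcing (τ ρ : ℝ) (x : ℝ → ℝ) (s : ℝ) : ℝ := x (ρ + min (s - τ) 0)

theorem forcing_of_le {τ ρ s : ℝ} (x : ℝ → ℝ) (hs : s ≤ τ) :
    forcing τ ρ x s = x (ρ + s - τ) := by
  rw [forcing, min_eq_left (by linarith)]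
  ring_nf

theorem forcing_of_ge {τ ρ s : ℝ} (x : ℝ → ℝ) (hs : τ ≤ s) : forcing τ ρ x s = x ρ := by
  rw [forcing, min_eq_right (by linarith), add_zero]

theorem IsPsiSol.exists_isMaxSol {τ ρ : ℝ} {x ψ : ℝ → ℝ} (h : IsPsiSol τ ρ x ψ) (hτ : 0 < τ)
    (hx : Continuous x) (hnonneg : ∀ t ≤ ρ, 0 ≤ x t) (hρ : x ρ = 0) :
    ∃ φ, IsMaxSol (forcing τ ρ x) φ ∧ ∀ t ≥ 0, φ t = ψ t := by
  obtain ⟨hc, h0, hint, hexp⟩ := h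
  have hψc : Continuous fun s => ψ (max s 0) :=
    hc.comp_continuous (by fun_prop) fun s => le_max_right s 0
  have hFc : Continuous (forcing τ ρ x) := hx.comp (by fun_prop)
  have hmc : Continuous fun s => max (forcing τ ρ x s) (ψ (max s 0)) := hFc.max hψc
  have hF0 : ∀ s, 0 ≤ forcing τ ρ x s := fun s => hnonneg _ (by
    linarith [min_le_right (s - τ) 0])
  have hψτ : ∀ t, 0 ≤ t → t ≤ τ → ψ t = ∫ s in (0:ℝ)..t, max (forcing τ ρ x s) (ψ (max s 0)) := by
    intro t ht0 htτ
    rw [hint t ⟨ht0, htτ⟩]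
    refine intervalIntegral.integral_congr fun s hs => ?_
    rw [uIcc_of_le ht0] at hs
    simp only [forcing_of_le x (hs.2.trans htτ), max_eq_left hs.1]
  have hψτ0 : 0 ≤ ψ τ := by
    rw [hψτ τ hτ.le le_rfl]
    exact intervalIntegral.integral_nonneg hτ.le fun s _ => (hF0 s).trans (le_max_left _ _)
  have hψnonneg : ∀ t ≥ τ, 0 ≤ ψ t := by
    set χ : ℝ → ℝ := fun t => ψ τ + ∫ s in τ..t, ψ (max s 0) with hχ
    have hχψ : ∀ t ≥ τ, χ t = ψ t := by
      intro t ht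
      rw [hexp t ht, hχ]
      simp only
      congr 1
      refine intervalIntegral.integral_congr fun s hs => ?_
      rw [uIcc_of_le ht] at hs
      simp only [max_eq_left (hτ.le.trans hs.1)]
    have hχd : ∀ t ≥ τ, HasDerivAt χ (χ t) t := by
      intro t ht
      have h1 := (hasDerivAt_integral_of_continuous hψc τ t).const_add (ψ τ)
      rwa [max_eq_left (hτ.le.trans ht), ← hχψ t ht] at h1
    have hd : ∀ t ≥ τ, HasDerivAt (fun t => χ t * exp (-t))
        (χ t * exp (-t) + χ t * (exp (-t) * -1)) t := fun t ht =>
      (hχd t ht).mul ((hasDerivAt_id t).neg.exp)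
    have hmono : MonotoneOn (fun t => χ t * exp (-t)) (Ici τ) := by
      apply monotoneOn_of_deriv_nonneg (convex_Ici τ)
      · exact fun t ht => (hd t ht).continuousAt.continuousWithinAt
      · exact fun t ht =>
          (hd t (interior_subset ht)).differentiableAt.differentiableWithinAt
      · intro t ht
        rw [(hd t (interior_subset ht)).deriv]
        linarith
    intro t ht
    have h1 := hmono (mem_Ici.2 le_rfl) ht ht
    simp only [hχψ τ le_rfl, hχψ t ht] at h1
    exact nonneg_of_mul_nonneg_left ((mul_nonneg hψτ0 (exp_pos _).le).trans h1) (exp_pos _)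
  have heq : ∀ t ≥ 0, ∫ s in (0:ℝ)..t, max (forcing τ ρ x s) (ψ (max s 0)) = ψ t := by
    intro t ht
    rcases le_total t τ with htτ | htτ
    · exact (hψτ t ht htτ).symm
    · rw [← intervalIntegral.integral_add_adjacent_intervals (hmc.intervalIntegrable 0 τ)
        (hmc.intervalIntegrable τ t), ← hψτ τ hτ.le le_rfl, hexp t htτ]
      congr 1
      refine intervalIntegral.integral_congr fun s hs => ?_
      rw [uIcc_of_le htτ] at hs
      simp only [max_eq_left (hτ.le.trans hs.1), forcing_of_ge x hs.1, hρ,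
        max_eq_right (hψnonneg s hs.1)]
  refine ⟨fun t => ∫ s in (0:ℝ)..t, max (forcing τ ρ x s) (ψ (max s 0)),
    ⟨by simp, fun t ht => ?_⟩, heq⟩
  have h1 := hasDerivAt_integral_of_continuous hmc 0 t
  simp only [max_eq_left ht] at h1
  simpa only [heq t ht] using h1

namespace IsXSol

variable {τ τ₁ τ₂ : ℝ} {x x₁ x₂ : ℝ → ℝ}

theorem forcing_nonneg (h : IsXSol τ x) (hτ : 1 / exp 1 < τ) (s : ℝ) :
    0 ≤ forcing τ (firstRoot x) x s :=
  h.nonneg_of_le_firstRoot hτ (by linarith [min_le_right (s - τ) 0])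

theorem forcing_pos (h : IsXSol τ x) (hτ : 1 / exp 1 < τ) {s : ℝ} (hs : s < τ) :
    0 < forcing τ (firstRoot x) x s :=
  h.pos_of_lt_firstRoot hτ _ (by linarith [min_le_left (s - τ) 0])

theorem forcing_le_one (h : IsXSol τ x) (hτ : 1 / exp 1 < τ) (s : ℝ) :
    forcing τ (firstRoot x) x s ≤ 1 := by
  have hτ0 : 0 < τ := lt_trans (by positivity) hτ
  exact h.le_one hτ (by linarith [min_le_right (s - τ) 0])

theorem forcing_mono (h₁ : IsXSol τ₁ x₁) (h₂ : IsXSol τ₂ x₂)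
    (hτ₁ : 1 / exp 1 < τ₁) (hτ : τ₁ < τ₂) (s : ℝ) :
    forcing τ₁ (firstRoot x₁) x₁ s ≤ forcing τ₂ (firstRoot x₂) x₂ s := by
  have hτ₂ := hτ₁.trans hτ
  have hτ0 : 0 < τ₂ := lt_trans (by positivity) hτ₂
  have h0 := min_le_right (s - τ₁) 0
  have hle : min (s - τ₂) 0 ≤ min (s - τ₁) 0 := min_le_min_right 0 (by linarith)
  have h1 := h₁.apply_firstRoot_sub_le h₂ hτ₁ hτ (neg_nonneg.2 h0)
  rw [sub_neg_eq_add, sub_neg_eq_add] at h1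
  exact h1.trans (h₂.antitoneOn hτ₂ (by simp only [mem_Iic]; linarith)
    (by simp only [mem_Iic]; linarith) (by linarith))

/-- A strictly larger delay makes the solution of the `max` equation strictly larger at the time
where the other one reaches `1`. -/
theorem one_lt_of_eq_one (h₁ : IsXSol τ₁ x₁) (h₂ : IsXSol τ₂ x₂)
    (hτ₁ : 1 / exp 1 < τ₁) (hτ : τ₁ < τ₂) (hτ₂ : τ₂ ≤ 2) {φ₁ φ₂ : ℝ → ℝ}
    (hφ₁ : IsMaxSol (forcing τ₁ (firstRoot x₁) x₁) φ₁)
    (hφ₂ : IsMaxSol (forcing τ₂ (firstRoot x₂) x₂) φ₂) {t : ℝ} (ht : 0 < t) (hφt : φ₁ t = 1) :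
    1 < φ₂ t := by
  have hτ0 : 0 < τ₁ := lt_trans (by positivity) hτ₁
  have hF := h₁.forcing_mono h₂ hτ₁ hτ
  set F₁ := forcing τ₁ (firstRoot x₁) x₁ with hF₁
  have hmono := hφ₁.strictMonoOn (fun s _ => h₁.forcing_nonneg hτ₁ s) hτ0
    fun s hs => h₁.forcing_pos hτ₁ hs
  have hF₁c : Continuous F₁ := h₁.1.comp (by fun_prop)
  obtain ⟨σ, hσ, hσ0⟩ := intermediate_value_Icc' (f := fun s => F₁ s - φ₁ s) ht.le
    (hF₁c.continuousOn.sub (hφ₁.continuousOn.mono Icc_subset_Ici_self))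
    (show (0:ℝ) ∈ Icc (F₁ t - φ₁ t) (F₁ 0 - φ₁ 0) by
      rw [hφt, hφ₁.1]
      exact ⟨sub_nonpos.2 (h₁.forcing_le_one hτ₁ t), by
        rw [sub_zero]; exact h₁.forcing_nonneg hτ₁ 0⟩)
  have hcross : F₁ σ = φ₁ σ := sub_eq_zero.1 hσ0
  have hσpos : 0 < σ := by
    refine hσ.1.lt_of_ne ?_
    rintro rfl
    have := h₁.forcing_pos hτ₁ hτ0
    rw [← hF₁, hcross, hφ₁.1] at this
    exact lt_irrefl _ this
  have hφpos : 0 < φ₁ σ := hφ₁.1 ▸ hmono (mem_Ici.2 le_rfl) hσpos.le hσpos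
  have hστ : σ < τ₁ := by
    by_contra! hle
    have := forcing_of_ge (ρ := firstRoot x₁) x₁ hle
    rw [(h₁.isLeast_firstRoot hτ₁).1.2, ← hF₁, hcross] at this
    exact hφpos.ne' this
  have hϱ₁ := h₁.one_le_firstRoot hτ₁
  have hφlt : φ₁ σ < 1 := by
    rcases hσ.2.eq_or_lt with rfl | hlt
    · have h1 := hφ₁.le_self (fun s _ => h₁.forcing_nonneg hτ₁ s)
        (fun s _ => h₁.forcing_le_one hτ₁ s) ht.le hφt.le
      have h2 := forcing_of_le (ρ := firstRoot x₁) x₁ hστ.le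
      rw [← hF₁, hcross, hφt, ← h₁.apply_zero] at h2
      have h3 := h₁.strictAntiOn hτ₁ (a := 0) (b := firstRoot x₁ + σ - τ₁)
        ⟨le_rfl, by linarith⟩ ⟨by linarith, by linarith⟩ (by linarith)
      linarith
    · rw [← hφt]
      exact hmono hσpos.le ht.le hlt
  have hσt : σ < t := by
    refine hσ.2.lt_of_ne ?_
    rintro rfl
    exact hφlt.ne hφt
  rw [← hφt]
  refine hφ₁.lt_of_max_lt hφ₂ (fun s _ => hF s) hσpos hσt ?_
  rw [hcross, max_self]
  have hle : F₁ σ ≤ x₂ (firstRoot x₂ + σ - τ₁) := by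
    have h1 := h₁.apply_firstRoot_sub_le h₂ hτ₁ hτ (sub_nonneg.2 hστ.le)
    rw [hF₁, forcing_of_le x₁ hστ.le]
    convert h1 using 2 <;> ring
  rw [forcing_of_le x₂ (hστ.trans hτ).le]
  rcases le_total (firstRoot x₂ + σ - τ₂) 0 with hneg | hneg
  · rwa [h₂.2.1 _ hneg]
  · rw [← hcross]
    exact hle.trans_lt (h₂.strictAntiOn (hτ₁.trans hτ) ⟨hneg, by linarith⟩
      ⟨by linarith, by linarith⟩ (by linarith))

end IsXSol

section Continuity

variable {X : ℝ → ℝ → ℝ} {τ₀ : ℝ}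

theorem eventually_abs_xSol_sub_lt (hX : ∀ τ > 1 / exp 1, IsXSol τ (X τ)) (hτ₀ : 1 / exp 1 < τ₀)
    {ε : ℝ} (hε : 0 < ε) :
    ∀ᶠ τ in nhds τ₀, ∀ t ≤ firstRoot (X τ₀) + τ₀, |X τ t - X τ₀ t| < ε := by
  obtain ⟨C, _, hC⟩ := (hX τ₀ hτ₀).exists_abs_sub_le_mul hτ₀
  have hlim : Tendsto (fun τ => C * |τ - τ₀|) (nhds τ₀) (nhds 0) := by
    have : Continuous fun τ => C * |τ - τ₀| := by fun_prop
    simpa using this.tendsto τ₀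
  filter_upwards [hlim.eventually (gt_mem_nhds hε), lt_mem_nhds hτ₀] with τ h1 h2 t ht
  exact (hC τ (X τ) h2 (hX τ h2) t ht).trans_lt h1

theorem tendsto_firstRoot (hX : ∀ τ > 1 / exp 1, IsXSol τ (X τ)) (hτ₀ : 1 / exp 1 < τ₀) :
    Tendsto (fun τ => firstRoot (X τ)) (nhds τ₀) (nhds (firstRoot (X τ₀))) := by
  have h₀ := hX τ₀ hτ₀
  have hτ0 : 0 < τ₀ := lt_trans (by positivity) hτ₀
  obtain ⟨hϱ0, hϱ⟩ := (h₀.isLeast_firstRoot hτ₀).1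
  set ϱ₀ := firstRoot (X τ₀)
  rw [tendsto_order]
  constructor
  · intro a ha
    have hpos := h₀.pos_of_lt_firstRoot hτ₀ a ha
    filter_upwards [eventually_abs_xSol_sub_lt hX hτ₀ hpos, lt_mem_nhds hτ₀] with τ h1 h2
    by_contra! hle
    have h3 := h1 (firstRoot (X τ)) (by linarith)
    rw [((hX τ h2).isLeast_firstRoot h2).1.2, abs_lt] at h3
    have h4 := h₀.antitoneOn hτ₀ (a := firstRoot (X τ)) (b := a)
      (by simp only [mem_Iic]; linarith) (by simp only [mem_Iic]; linarith) hle
    linarith [h3.1]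
  · intro a ha
    set c := min a (ϱ₀ + τ₀)
    have hc : ϱ₀ < c := lt_min ha (by linarith)
    have hc' : c ≤ ϱ₀ + τ₀ := min_le_right _ _
    have hneg : X τ₀ c < 0 := hϱ ▸ h₀.strictAntiOn hτ₀ (a := ϱ₀) (b := c)
      ⟨hϱ0.le, by linarith⟩ ⟨by linarith, hc'⟩ hc
    filter_upwards [eventually_abs_xSol_sub_lt hX hτ₀ (neg_pos.2 hneg), lt_mem_nhds hτ₀]
      with τ h1 h2
    refine lt_of_lt_of_le ?_ (min_le_left a (ϱ₀ + τ₀))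
    by_contra! hle
    have h3 := (hX τ h2).nonneg_of_le_firstRoot h2 hle
    have h4 := (abs_lt.1 (h1 c hc')).2
    linarith

theorem eventually_abs_forcing_sub_le (hX : ∀ τ > 1 / exp 1, IsXSol τ (X τ))
    (hτ₀ : 1 / exp 1 < τ₀) {ε : ℝ} (hε : 0 < ε) :
    ∀ᶠ τ in nhds τ₀, ∀ s, |forcing τ (firstRoot (X τ)) (X τ) s -
      forcing τ₀ (firstRoot (X τ₀)) (X τ₀) s| ≤ ε := by
  have h₀ := hX τ₀ hτ₀
  have hτ0 : 0 < τ₀ := lt_trans (by positivity) hτ₀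
  have hε3 : 0 < ε / 3 := by positivity
  have hr := (tendsto_firstRoot hX hτ₀).eventually
    (Metric.ball_mem_nhds _ (lt_min hε3 hτ0))
  filter_upwards [hr, Metric.ball_mem_nhds τ₀ hε3, eventually_abs_xSol_sub_lt hX hτ₀ hε3]
    with τ h1 h2 h3 s
  rw [Real.dist_eq] at h1
  rw [Metric.mem_ball, Real.dist_eq] at h2
  have h1a := h1.trans_le (min_le_left _ _)
  have h1b := (abs_lt.1 (h1.trans_le (min_le_right _ _))).2
  have hmin : |min (s - τ) 0 - min (s - τ₀) 0| ≤ |τ - τ₀| := by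
    refine (abs_min_sub_min_le_max _ _ _ _).trans ?_
    rw [sub_self, abs_zero, show s - τ - (s - τ₀) = -(τ - τ₀) by ring, abs_neg]
    exact max_le le_rfl (abs_nonneg _)
  have hp : firstRoot (X τ) + min (s - τ) 0 ≤ firstRoot (X τ₀) + τ₀ := by
    linarith [min_le_right (s - τ) 0]
  have hq : firstRoot (X τ₀) + min (s - τ₀) 0 ≤ firstRoot (X τ₀) + τ₀ := by
    linarith [min_le_right (s - τ₀) 0]
  have e1 := h3 _ hp
  have e2 := h₀.abs_apply_sub_apply_le hτ₀ hp hq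
  rw [add_sub_add_comm] at e2
  have e3 := abs_add_le (firstRoot (X τ) - firstRoot (X τ₀)) (min (s - τ) 0 - min (s - τ₀) 0)
  have e4 := abs_sub_le (X τ (firstRoot (X τ) + min (s - τ) 0))
    (X τ₀ (firstRoot (X τ) + min (s - τ) 0)) (X τ₀ (firstRoot (X τ₀) + min (s - τ₀) 0))
  simp only [forcing]
  linarith

theorem tendsto_maxSol (hX : ∀ τ > 1 / exp 1, IsXSol τ (X τ)) (hτ₀ : 1 / exp 1 < τ₀)
    {S : Set ℝ} (hS : τ₀ ∈ S) {Φ : ℝ → ℝ → ℝ}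
    (hΦ : ∀ τ ∈ S, IsMaxSol (forcing τ (firstRoot (X τ)) (X τ)) (Φ τ)) {t : ℝ} (ht : 0 ≤ t) :
    Tendsto (fun τ => Φ τ t) (nhdsWithin τ₀ S) (nhds (Φ τ₀ t)) := by
  rw [Metric.tendsto_nhds]
  intro ε hε
  have hpos := exp_pos (2 * t)
  have hε' : 0 < ε / 2 / exp (2 * t) := by positivity
  filter_upwards [nhdsWithin_le_nhds (eventually_abs_forcing_sub_le hX hτ₀ hε'),
    self_mem_nhdsWithin] with τ h1 hτ
  have e1 := (hΦ τ hτ).le_add_mul_exp (hΦ τ₀ hS) hε'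
    (fun s _ => by linarith [(abs_le.1 (h1 s)).2]) ht
  have e2 := (hΦ τ₀ hS).le_add_mul_exp (hΦ τ hτ) hε'
    (fun s _ => by linarith [(abs_le.1 (h1 s)).1]) ht
  rw [div_mul_cancel₀ _ hpos.ne'] at e1 e2
  rw [Real.dist_eq, abs_lt]
  constructor <;> linarith

end Continuity

theorem stmt6
    (X : ℝ → ℝ → ℝ) (hX : ∀ τ > 1 / Real.exp 1, IsXSol τ (X τ))
    (ϱ : ℝ → ℝ) (hϱ : ∀ τ, ϱ τ = firstRoot (X τ))
    (Ψ : ℝ → ℝ → ℝ)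
    (hΨ : ∀ τ ∈ Ioc (1 / Real.exp 1) 2, IsPsiSol τ (ϱ τ) (X τ) (Ψ τ))
    (Λ : ℝ → ℝ)
    (hΛ : ∀ τ ∈ Ioc (1 / Real.exp 1) 2, ϱ τ < Λ τ ∧ Ψ τ (Λ τ - ϱ τ) = 1) :
    ContinuousOn Λ (Ioc (1 / Real.exp 1) 2) ∧
    StrictAntiOn Λ (Ioc (1 / Real.exp 1) 2) := by
  obtain rfl : ϱ = fun τ => firstRoot (X τ) := funext hϱ
  set S := Ioc (1 / exp 1) 2
  have hpos : ∀ τ ∈ S, 0 < τ := fun τ hτ => lt_trans (by positivity) hτ.1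
  have hex : ∀ τ ∈ S, ∃ φ, IsMaxSol (forcing τ (firstRoot (X τ)) (X τ)) φ ∧
      ∀ t ≥ 0, φ t = Ψ τ t := fun τ hτ =>
    (hΨ τ hτ).exists_isMaxSol (hpos τ hτ) (hX τ hτ.1).1
      (fun t ht => (hX τ hτ.1).nonneg_of_le_firstRoot hτ.1 ht)
      ((hX τ hτ.1).isLeast_firstRoot hτ.1).1.2
  choose! Φ hΦ hΦΨ using hex
  have hmono : ∀ τ ∈ S, StrictMonoOn (Φ τ) (Ici 0) := fun τ hτ =>
    (hΦ τ hτ).strictMonoOn (fun s _ => (hX τ hτ.1).forcing_nonneg hτ.1 s) (hpos τ hτ)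
      fun s hs => (hX τ hτ.1).forcing_pos hτ.1 hs
  have hL0 : ∀ τ ∈ S, 0 < Λ τ - firstRoot (X τ) := fun τ hτ => sub_pos.2 (hΛ τ hτ).1
  have hL1 : ∀ τ ∈ S, Φ τ (Λ τ - firstRoot (X τ)) = 1 := fun τ hτ =>
    (hΦΨ τ hτ _ (hL0 τ hτ).le).trans (hΛ τ hτ).2
  constructor
  · intro τ₀ hτ₀
    have hL : Tendsto (fun τ => Λ τ - firstRoot (X τ)) (nhdsWithin τ₀ S)
        (nhds (Λ τ₀ - firstRoot (X τ₀))) := by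
      rw [tendsto_order]
      constructor
      · intro a ha
        rcases lt_or_ge a 0 with ha0 | ha0
        · filter_upwards [self_mem_nhdsWithin] with τ hτ using ha0.trans (hL0 τ hτ)
        have h1 : Φ τ₀ a < 1 := hL1 τ₀ hτ₀ ▸ hmono τ₀ hτ₀ ha0 (hL0 τ₀ hτ₀).le ha
        filter_upwards [(tendsto_maxSol hX hτ₀.1 hτ₀ hΦ ha0).eventually (gt_mem_nhds h1),
          self_mem_nhdsWithin] with τ h2 hτ
        rw [← hL1 τ hτ] at h2
        exact ((hmono τ hτ).lt_iff_lt ha0 (hL0 τ hτ).le).1 h2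
      · intro a ha
        have ha0 : 0 ≤ a := (hL0 τ₀ hτ₀).le.trans ha.le
        have h1 : 1 < Φ τ₀ a := hL1 τ₀ hτ₀ ▸ hmono τ₀ hτ₀ (hL0 τ₀ hτ₀).le ha0 ha
        filter_upwards [(tendsto_maxSol hX hτ₀.1 hτ₀ hΦ ha0).eventually (lt_mem_nhds h1),
          self_mem_nhdsWithin] with τ h2 hτ
        rw [← hL1 τ hτ] at h2
        exact ((hmono τ hτ).lt_iff_lt (hL0 τ hτ).le ha0).1 h2
    simpa [ContinuousWithinAt] using
      hL.add ((tendsto_firstRoot hX hτ₀.1).mono_left nhdsWithin_le_nhds)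
  · intro τ₁ hτ₁ τ₂ hτ₂ hlt
    have h1 := (hX τ₁ hτ₁.1).one_lt_of_eq_one (hX τ₂ hτ₂.1) hτ₁.1 hlt hτ₂.2 (hΦ τ₁ hτ₁)
      (hΦ τ₂ hτ₂) (hL0 τ₁ hτ₁) (hL1 τ₁ hτ₁)
    rw [← hL1 τ₂ hτ₂] at h1
    have h2 := ((hmono τ₂ hτ₂).lt_iff_lt (hL0 τ₂ hτ₂).le (hL0 τ₁ hτ₁).le).1 h1
    have h3 := (hX τ₁ hτ₁.1).firstRoot_le_firstRoot (hX τ₂ hτ₂.1) hτ₁.1 hlt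
    linarith
end
end

section
/- Let x be an α-oscillating solution of x'(t) = p(t)·x(τ̄(t)) on [t₀,∞) with |p| ≡ 1 and τ_m := sup_{t ≥ t₀}(t - τ̄(t)) ∈ (1/e, 2]. If α ≤ Λ(τ_m), then x is bounded on [t₀, ∞). If moreover α < Λ(τ_m), then x(t) → 0 as t → ∞. -/
open Real MeasureTheory Filter Set

noncomputable section

section FundamentalSolution

variable {τ : ℝ} {y : ℝ → ℝ}

lemma IsXSol.sub_eq_s8 (hy : IsXSol τ y) {s t : ℝ} (hs : 0 ≤ s) (ht : 0 ≤ t) :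
    y s - y t = ∫ u in s..t, y (u - τ) := by
  have hc : Continuous fun u => y (u - τ) := hy.1.comp (by fun_prop)
  rw [hy.2.2 s hs, hy.2.2 t ht, ← intervalIntegral.integral_interval_sub_left
    (hc.intervalIntegrable 0 t) (hc.intervalIntegrable 0 s)]
  ring

lemma firstRoot_nonneg (y : ℝ → ℝ) : 0 ≤ firstRoot y :=
  Real.sInf_nonneg fun _ ht => ht.1.le

lemma IsXSol.pos_of_lt_firstRoot_s8 (hy : IsXSol τ y) {t : ℝ} (ht : t < firstRoot y) : 0 < y t := by
  rcases le_or_gt t 0 with h0 | h0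
  · rw [hy.2.1 t h0]
    exact one_pos
  by_contra! hneg
  obtain ⟨u, hu, hu0⟩ := intermediate_value_Icc' h0.le hy.1.continuousOn
    (show (0 : ℝ) ∈ Icc (y t) (y 0) from ⟨hneg, by rw [hy.2.1 0 le_rfl]; exact zero_le_one⟩)
  have hupos : 0 < u := by
    rcases hu.1.eq_or_lt with h | h
    · rw [← h, hy.2.1 0 le_rfl] at hu0
      exact absurd hu0 one_ne_zero
    · exact h
  have : firstRoot y ≤ u := csInf_le ⟨0, fun _ hv => hv.1.le⟩ ⟨hupos, hu0⟩
  linarith [hu.2]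

lemma IsXSol.lt_of_lt (hy : IsXSol τ y) (hτ : 0 < τ) {s t : ℝ} (hs : 0 ≤ s) (hst : s < t)
    (ht : t ≤ firstRoot y) : y t < y s := by
  have hc : Continuous fun u => y (u - τ) := hy.1.comp (by fun_prop)
  have := intervalIntegral.intervalIntegral_pos_of_pos_on (hc.intervalIntegrable s t)
    (fun u hu => hy.pos_of_lt_firstRoot_s8 (by linarith [hu.2])) hst
  linarith [hy.sub_eq_s8 hs (hs.trans hst.le)]

lemma IsXSol.antitoneOn_s8 (hy : IsXSol τ y) (hτ : 0 < τ) : AntitoneOn y (Iic (firstRoot y)) := by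
  intro s _ t ht hst
  rcases hst.eq_or_lt with rfl | hlt
  · exact le_rfl
  rcases le_or_gt t 0 with h0 | h0
  · rw [hy.2.1 t h0, hy.2.1 s (hst.trans h0)]
  rcases le_or_gt 0 s with hs | hs
  · exact (hy.lt_of_lt hτ hs hlt ht).le
  · rw [hy.2.1 s hs.le, ← hy.2.1 0 le_rfl]
    exact (hy.lt_of_lt hτ le_rfl h0 ht).le

end FundamentalSolution

section Majorant

variable {τ : ℝ} {y ψ : ℝ → ℝ}

lemma IsPsiSol.continuousOn_max (hy : IsXSol τ y) (hψ : IsPsiSol τ (firstRoot y) y ψ) :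
    ContinuousOn (fun s => max (y (firstRoot y + s - τ)) (ψ s)) (Ici 0) :=
  (hy.1.comp (by fun_prop : Continuous fun s : ℝ => firstRoot y + s - τ)).continuousOn.sup hψ.1

lemma IsPsiSol.strictMonoOn_Icc (hy : IsXSol τ y) (hψ : IsPsiSol τ (firstRoot y) y ψ) :
    StrictMonoOn ψ (Icc 0 τ) := by
  intro s hs t ht hst
  have hi : ∀ a b : ℝ, 0 ≤ a → a ≤ b → IntervalIntegrable
      (fun s => max (y (firstRoot y + s - τ)) (ψ s)) volume a b := fun a b ha hab =>
    ((hψ.continuousOn_max hy).mono fun u hu => ha.trans hu.1).intervalIntegrable_of_Icc hab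
  have hpos := intervalIntegral.intervalIntegral_pos_of_pos_on (hi s t hs.1 hst.le)
    (fun u hu => lt_max_of_lt_left
      (hy.pos_of_lt_firstRoot_s8 (show firstRoot y + u - τ < _ by linarith [hu.2, ht.2]))) hst
  rw [hψ.2.2.1 s hs, hψ.2.2.1 t ht, ← intervalIntegral.integral_add_adjacent_intervals
    (hi 0 s le_rfl hs.1) (hi s t hs.1 hst.le)]
  linarith

lemma IsPsiSol.apply_delay_pos (hy : IsXSol τ y) (hψ : IsPsiSol τ (firstRoot y) y ψ)
    (hτ : 0 < τ) : 0 < ψ τ := by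
  have := hψ.strictMonoOn_Icc hy ⟨le_rfl, hτ.le⟩ ⟨hτ.le, le_rfl⟩ hτ
  rwa [hψ.2.1] at this

lemma IsPsiSol.intervalIntegrable (hψ : IsPsiSol τ (firstRoot y) y ψ) {a b : ℝ} (ha : 0 ≤ a)
    (hab : a ≤ b) : IntervalIntegrable ψ volume a b :=
  (hψ.1.mono fun _ hu => ha.trans hu.1).intervalIntegrable_of_Icc hab

lemma IsPsiSol.pos_of_delay_le (hy : IsXSol τ y) (hψ : IsPsiSol τ (firstRoot y) y ψ)
    (hτ : 0 < τ) {t : ℝ} (ht : τ ≤ t) : 0 < ψ t := by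
  by_contra! hneg
  have hcomp : IsCompact (Icc τ t ∩ ψ ⁻¹' Iic 0) :=
    isCompact_Icc.of_isClosed_subset ((hψ.1.mono fun _ hu =>
      hτ.le.trans hu.1).preimage_isClosed_of_isClosed isClosed_Icc isClosed_Iic) inter_subset_left
  obtain ⟨r, ⟨hr, hr0⟩, hmin⟩ := hcomp.exists_isLeast ⟨t, ⟨ht, le_rfl⟩, hneg⟩
  have hint : 0 ≤ ∫ s in τ..r, ψ s := by
    refine intervalIntegral.integral_nonneg_of_ae_restrict hr.1 ?_
    rw [Filter.EventuallyLE, Measure.restrict_congr_set Ico_ae_eq_Icc.symm]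
    refine (ae_restrict_iff' measurableSet_Ico).2 (Eventually.of_forall fun u hu => ?_)
    by_contra! h
    exact absurd (hmin ⟨⟨hu.1, hu.2.le.trans hr.2⟩, h.le⟩) (not_le.2 hu.2)
  have := hψ.2.2.2 r hr.1
  have h1 : ψ r ≤ 0 := hr0
  linarith [hψ.apply_delay_pos hy hτ]

lemma IsPsiSol.strictMonoOn (hy : IsXSol τ y) (hψ : IsPsiSol τ (firstRoot y) y ψ)
    (hτ : 0 < τ) : StrictMonoOn ψ (Ici 0) := by
  have hright : StrictMonoOn ψ (Ici τ) := by
    intro s hs t ht hst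
    have hs' : τ ≤ s := hs
    have hpos := intervalIntegral.intervalIntegral_pos_of_pos_on
      (hψ.intervalIntegrable (hτ.le.trans hs') hst.le)
      (fun u hu => hψ.pos_of_delay_le hy hτ (hs'.trans hu.1.le)) hst
    rw [hψ.2.2.2 s hs, hψ.2.2.2 t ht, ← intervalIntegral.integral_add_adjacent_intervals
      (hψ.intervalIntegrable hτ.le hs') (hψ.intervalIntegrable (hτ.le.trans hs') hst.le)]
    linarith
  have := (hψ.strictMonoOn_Icc hy).union hright (isGreatest_Icc hτ.le) isLeast_Ici
  rwa [Icc_union_Ici_eq_Ici hτ.le] at this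

lemma IsPsiSol.nonneg (hy : IsXSol τ y) (hψ : IsPsiSol τ (firstRoot y) y ψ)
    (hτ : 0 < τ) {t : ℝ} (ht : 0 ≤ t) : 0 ≤ ψ t := by
  have := (hψ.strictMonoOn hy hτ).monotoneOn (mem_Ici.2 le_rfl) (mem_Ici.2 ht) ht
  rwa [hψ.2.1] at this

end Majorant

section Oscillation

variable {α τ t₀ : ℝ} {x y ψ p τd : ℝ → ℝ}

/-- Increments of a solution are controlled by a majorant of the retarded values. -/
lemma IsDelaySolution.abs_sub_le (hx : IsDelaySolution p τd t₀ x) (hpm : Measurable p)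
    (hτdm : Measurable τd) (hp1 : ∀ᵐ t : ℝ ∂volume, |p t| = 1) (hτdle : ∀ t, τd t ≤ t)
    (hdel : ∀ s ≥ t₀, s - τ ≤ τd s) {a b : ℝ} (ha : t₀ ≤ a) (hab : a ≤ b) {G : ℝ → ℝ}
    (hG : ContinuousOn G (Icc a b)) (hle : ∀ s ∈ Icc a b, |x (τd s)| ≤ G s) :
    |x b - x a| ≤ ∫ s in a..b, G s := by
  have hi : ∀ a b : ℝ, t₀ ≤ a → a ≤ b →
      IntervalIntegrable (fun s => p s * x (τd s)) volume a b := by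
    intro a b ha hab
    obtain ⟨C, hC⟩ := (isCompact_Icc (a := a - τ) (b := b)).exists_bound_of_continuousOn
      hx.1.continuousOn
    rw [intervalIntegrable_iff_integrableOn_Icc_of_le hab]
    refine Measure.integrableOn_of_bounded (M := C) (by simp)
      (hpm.mul (hx.1.measurable.comp hτdm)).aestronglyMeasurable ?_
    refine (ae_restrict_iff' measurableSet_Icc).2 (hp1.mono fun s hs hmem => ?_)
    rw [norm_mul, Real.norm_eq_abs, hs, one_mul]
    exact hC _ ⟨by linarith [hdel s (ha.trans hmem.1), hmem.1], (hτdle s).trans hmem.2⟩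
  have heq : x b - x a = ∫ s in a..b, p s * x (τd s) := by
    rw [hx.2 a ha, hx.2 b (ha.trans hab), ← intervalIntegral.integral_interval_sub_left
      (hi _ _ le_rfl (ha.trans hab)) (hi _ _ le_rfl ha)]
    ring
  rw [heq, ← Real.norm_eq_abs]
  refine intervalIntegral.norm_integral_le_of_norm_le hab ?_ (hG.intervalIntegrable_of_Icc hab)
  filter_upwards [hp1] with s hs hmem
  rw [norm_mul, Real.norm_eq_abs, hs, one_mul]
  exact hle s (Ioc_subset_Icc_self hmem)

/-- Before a zero, a solution lies below the translate of the fundamental solution. -/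
lemma abs_le_before_zero
    (hxc : Continuous x) (hτdle : ∀ t, τd t ≤ t) (hdel : ∀ s ≥ t₀, s - τ ≤ τd s)
    (hstep : ∀ ⦃a b : ℝ⦄, t₀ ≤ a → a ≤ b → ∀ ⦃G : ℝ → ℝ⦄, ContinuousOn G (Icc a b) →
      (∀ s ∈ Icc a b, |x (τd s)| ≤ G s) → |x b - x a| ≤ ∫ s in a..b, G s)
    (hy : IsXSol τ y) (hτ : 0 < τ)
    {b M : ℝ} (hb : t₀ + firstRoot y ≤ b) (hb0 : x b = 0)
    (hM : ∀ t ∈ Icc (b - firstRoot y - τ) b, |x t| ≤ M) {t : ℝ}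
    (ht : t ∈ Icc (b - firstRoot y - τ) b) : |x t| ≤ M * y (firstRoot y + t - b) := by
  set ρ := firstRoot y with hρ
  rcases le_or_gt (ρ + t - b) 0 with h0 | h0
  · rw [hy.2.1 _ h0, mul_one]
    exact hM t ht
  by_contra! hlt
  have hM0 : 0 ≤ M := (abs_nonneg _).trans (hM t ht)
  have hev : ∀ᶠ η in nhdsWithin (0 : ℝ) (Ioi 0), M * y (ρ + t - b - η) < |x t| := by
    have hc : Continuous fun η : ℝ => M * y (ρ + t - b - η) :=
      continuous_const.mul (hy.1.comp (by fun_prop))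
    refine nhdsWithin_le_nhds ((hc.tendsto 0).eventually_lt_const ?_)
    simpa using hlt
  obtain ⟨η, hη, hηpos⟩ := (hev.and self_mem_nhdsWithin).exists
  set z : ℝ → ℝ := fun s => y (ρ + s - b - η) with hz
  have hzc : Continuous z := hy.1.comp (by fun_prop)
  have hzpos : ∀ s ≤ b, 0 < z s := fun s hs =>
    hy.pos_of_lt_firstRoot_s8 (show ρ + s - b - η < ρ by linarith)
  obtain ⟨w, hw, hmax⟩ := isCompact_Icc.exists_isMaxOn ⟨t, ht⟩
    (f := fun s => |x s| / z s) (hxc.abs.continuousOn.div hzc.continuousOn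
      fun s hs => (hzpos s hs.2).ne')
  set K := |x w| / z w with hK
  have hMK : M < K := ((lt_div_iff₀ (hzpos t ht.2)).2 hη).trans_le (hmax ht)
  have hle : ∀ s ∈ Icc (b - ρ - τ) b, |x s| ≤ K * z s := fun s hs =>
    (div_le_iff₀ (hzpos s hs.2)).1 (hmax hs)
  have hwpos : 0 < ρ + w - b - η := by
    by_contra! h
    have hzw : z w = 1 := hy.2.1 _ h
    rw [hzw, div_one] at hK
    linarith [hM w hw]
  have hinc : |x b - x w| ≤ ∫ s in w..b, K * z (s - τ) := by
    refine hstep (by linarith) hw.2 (by fun_prop) fun s hs => ?_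
    have h1 := hdel s (by linarith [hs.1])
    refine (hle _ ⟨by linarith [hs.1], (hτdle s).trans hs.2⟩).trans ?_
    refine mul_le_mul_of_nonneg_left ?_ (hM0.trans hMK.le)
    have h2 := hτdle s
    refine hy.antitoneOn_s8 hτ ?_ ?_ (by linarith) <;> rw [mem_Iic] <;> linarith [hs.2]
  have hzint : ∫ s in w..b, z (s - τ) = z w - z b := by
    have h1 := hy.sub_eq_s8 (s := ρ + w - b - η) (t := ρ + b - b - η) hwpos.le (by linarith [hw.2])
    simp only [hz]
    rw [h1]
    have h2 := intervalIntegral.integral_comp_add_right (a := w) (b := b)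
      (fun u => y (u - τ)) (ρ - b - η)
    rw [show w + (ρ - b - η) = ρ + w - b - η by ring,
      show b + (ρ - b - η) = ρ + b - b - η by ring] at h2
    rw [← h2]
    congr 1
    ext u
    congr 1
    ring
  rw [intervalIntegral.integral_const_mul, hzint, hb0, zero_sub, abs_neg,
    show |x w| = K * z w by rw [hK, div_mul_cancel₀ _ (hzpos w hw.2).ne']] at hinc
  nlinarith [mul_pos (hM0.trans_lt hMK) (hzpos b le_rfl)]

/-- After a zero, a solution lies below the majorant `ψ`. -/
lemma abs_le_after_zero
    (hxc : Continuous x) (hτdle : ∀ t, τd t ≤ t) (hdel : ∀ s ≥ t₀, s - τ ≤ τd s)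
    (hstep : ∀ ⦃a b : ℝ⦄, t₀ ≤ a → a ≤ b → ∀ ⦃G : ℝ → ℝ⦄, ContinuousOn G (Icc a b) →
      (∀ s ∈ Icc a b, |x (τd s)| ≤ G s) → |x b - x a| ≤ ∫ s in a..b, G s)
    (hy : IsXSol τ y) (hψ : IsPsiSol τ (firstRoot y) y ψ) (hτ : 0 < τ)
    {b M : ℝ} (hb : t₀ + firstRoot y ≤ b) (hb0 : x b = 0)
    (hM : ∀ t ∈ Icc (b - firstRoot y - τ) b, |x t| ≤ M) {t : ℝ} (ht : 0 ≤ t) :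
    |x (b + t)| ≤ M * ψ t := by
  set ρ := firstRoot y with hρ
  have hρ0 : 0 ≤ ρ := firstRoot_nonneg y
  have hM0 : 0 ≤ M := (abs_nonneg _).trans (hM b ⟨by linarith, le_rfl⟩)
  refine le_of_forall_pos_le_add fun δ hδ => ?_
  set ε := δ / exp (2 * t) with hε
  have hεpos : 0 < ε := by positivity
  set φ : ℝ → ℝ := fun s => M * ψ s + ε * exp (2 * s) with hφ
  have hφt : M * ψ t + δ = φ t := by
    simp only [hφ, hε]
    field_simp
  rw [hφt]
  by_contra! hviol
  have hφc : ContinuousOn φ (Ici 0) :=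
    (continuousOn_const.mul hψ.1).add (by fun_prop)
  have hφmono : MonotoneOn φ (Ici 0) := fun u hu v hv huv =>
    add_le_add (mul_le_mul_of_nonneg_left ((hψ.strictMonoOn hy hτ).monotoneOn hu hv huv) hM0)
      (by gcongr)
  have hxb : Continuous fun s => |x (b + s)| := by fun_prop
  have hcomp : IsCompact (Icc 0 t ∩ (fun s => |x (b + s)| - φ s) ⁻¹' Ici 0) :=
    isCompact_Icc.of_isClosed_subset ((hxb.continuousOn.sub
      (hφc.mono fun _ hu => hu.1)).preimage_isClosed_of_isClosed isClosed_Icc isClosed_Ici)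
      inter_subset_left
  obtain ⟨r, ⟨hr, hr0⟩, hmin⟩ := hcomp.exists_isLeast
    ⟨t, ⟨ht, le_rfl⟩, show (0 : ℝ) ≤ _ by linarith⟩
  have hr1 : φ r ≤ |x (b + r)| := sub_nonneg.1 hr0
  have hlt : ∀ s ∈ Ico 0 r, |x (b + s)| < φ s := by
    intro s hs
    by_contra! h
    exact absurd (hmin ⟨⟨hs.1, hs.2.le.trans hr.2⟩, sub_nonneg.2 h⟩) (not_le.2 hs.2)
  have hrpos : 0 < r := by
    rcases hr.1.eq_or_lt with h | h
    · rw [← h] at hr1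
      simp only [hφ, hψ.2.1, mul_zero, zero_add, Real.exp_zero, mul_one, add_zero, hb0,
        abs_zero] at hr1
      linarith
    · exact h
  have hexp : ∀ u v : ℝ, ∫ s in u..v, ε * exp (2 * s) = ε * (exp (2 * v) - exp (2 * u)) / 2 := by
    intro u v
    rw [intervalIntegral.integral_const_mul, intervalIntegral.integral_comp_mul_left _ two_ne_zero,
      integral_exp, smul_eq_mul]
    ring
  have hφle : ∀ s ∈ Icc 0 r, |x (b + s)| ≤ φ s := by
    intro s hs
    refine ContinuousWithinAt.closure_le (s := Ico 0 r) (x := s) ?_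
      hxb.continuousWithinAt ((hφc s hs.1).mono fun _ hu => hu.1) fun u hu => (hlt u hu).le
    rwa [closure_Ico hrpos.ne]
  have hret : ∀ s ∈ Icc b (b + r), b ≤ τd s → |x (τd s)| ≤ φ (s - b) := by
    intro s hs hbs
    have h1 := hφle (τd s - b) ⟨by linarith, by linarith [hs.2, hτdle s]⟩
    rw [add_sub_cancel] at h1
    exact h1.trans (hφmono (mem_Ici.2 (by linarith)) (mem_Ici.2 (by linarith [hs.1]))
      (by linarith [hτdle s]))
  have hintψ : ∀ {u v : ℝ}, 0 ≤ u → u ≤ v → IntervalIntegrable (fun s => M * ψ s) volume u v :=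
    fun hu huv => (hψ.intervalIntegrable hu huv).const_mul M
  have hintexp : ∀ u v : ℝ, IntervalIntegrable (fun s => ε * exp (2 * s)) volume u v :=
    fun u v => Continuous.intervalIntegrable (by fun_prop) u v
  rcases le_or_gt r τ with hrτ | hrτ
  · set g : ℝ → ℝ := fun s => M * max (y (ρ + s - τ)) (ψ s) + ε * exp (2 * s) with hg
    have hmc : ContinuousOn (fun s => M * max (y (ρ + s - τ)) (ψ s)) (Ici 0) :=
      continuousOn_const.mul (hψ.continuousOn_max hy)
    have hgc : ContinuousOn g (Ici 0) := hmc.add (by fun_prop)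
    have hinc : |x (b + r) - x b| ≤ ∫ s in b..(b + r), g (s - b) := by
      refine hstep (by linarith) (by linarith) ?_ fun s hs => ?_
      · exact hgc.comp (by fun_prop) fun s hs => mem_Ici.2 (by linarith [hs.1])
      have hd := hdel s (by linarith [hs.1])
      rcases le_or_gt (τd s) b with h | h
      · refine (abs_le_before_zero hxc hτdle hdel hstep hy hτ hb hb0 hM
          ⟨by linarith [hs.1], h⟩).trans ?_
        have h1 : y (ρ + τd s - b) ≤ y (ρ + (s - b) - τ) := by
          refine hy.antitoneOn_s8 hτ ?_ ?_ (by linarith) <;> rw [mem_Iic] <;> linarith [hs.2]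
        have h2 : M * y (ρ + τd s - b) ≤ M * max (y (ρ + (s - b) - τ)) (ψ (s - b)) :=
          mul_le_mul_of_nonneg_left (h1.trans (le_max_left _ _)) hM0
        have h3 : 0 < ε * exp (2 * (s - b)) := by positivity
        simp only [hg]
        linarith
      · refine (hret s hs h.le).trans ?_
        simp only [hg, hφ]
        gcongr
        exact le_max_right _ _
    rw [intervalIntegral.integral_comp_sub_right, sub_self, add_sub_cancel_left] at hinc
    simp only [hg] at hinc
    rw [intervalIntegral.integral_add ((hmc.mono fun _ hu => hu.1).intervalIntegrable_of_Icc hr.1)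
      (hintexp _ _), hexp, intervalIntegral.integral_const_mul, ← hψ.2.2.1 r ⟨hr.1, hrτ⟩, hb0,
      sub_zero, mul_zero, Real.exp_zero] at hinc
    simp only [hφ] at hr1
    nlinarith [mul_pos hεpos (exp_pos (2 * r))]
  · have hinc : |x (b + r) - x (b + τ)| ≤ ∫ s in (b + τ)..(b + r), φ (s - b) := by
      refine hstep (by linarith) (by linarith) ?_ fun s hs => ?_
      · exact hφc.comp (by fun_prop) fun s hs => mem_Ici.2 (by linarith [hs.1])
      have hd := hdel s (by linarith [hs.1])
      exact hret s ⟨by linarith [hs.1], hs.2⟩ (by linarith [hs.1])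
    rw [intervalIntegral.integral_comp_sub_right, add_sub_cancel_left, add_sub_cancel_left] at hinc
    simp only [hφ] at hinc
    have hψr := hψ.2.2.2 r hrτ.le
    rw [intervalIntegral.integral_add (hintψ hτ.le hrτ.le) (hintexp _ _), hexp,
      intervalIntegral.integral_const_mul,
      show ∫ s in τ..r, ψ s = ψ r - ψ τ by linarith] at hinc
    have h1 := hlt τ ⟨hτ.le, hrτ⟩
    simp only [hφ] at hr1 h1
    have h2 : ε * exp (2 * τ) < ε * exp (2 * r) := by gcongr
    have h3 := abs_sub_abs_le_abs_sub (x (b + r)) (x (b + τ))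
    nlinarith

/-- A nonvanishing point of an `α`-oscillating function lies between two zeros whose distance is
at most `α`. -/
lemma exists_zero_Icc (hxc : Continuous x) (hα : 0 < α) {T : ℝ}
    (hT : ∀ a b : ℝ, T ≤ a → a < b → (∀ t ∈ Ioo a b, x t ≠ 0) → b - a ≤ α)
    {b₀ t : ℝ} (hTb : T ≤ b₀) (hb₀ : x b₀ = 0) (hbt : b₀ ≤ t) :
    ∃ a b : ℝ, b₀ ≤ a ∧ a ≤ t ∧ t ≤ b ∧ x a = 0 ∧ x b = 0 ∧ b - a ≤ α := by
  have hzero : IsClosed (x ⁻¹' {0}) := isClosed_singleton.preimage hxc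
  obtain ⟨a, ⟨ha, ha0⟩, hamax⟩ := (isCompact_Icc.inter_right hzero :
    IsCompact (Icc b₀ t ∩ x ⁻¹' {0})).exists_isGreatest ⟨b₀, ⟨le_rfl, hbt⟩, hb₀⟩
  obtain ⟨c, hc, hc0⟩ : ∃ c ∈ Ioo t (t + α + 1), x c = 0 := by
    by_contra! h
    linarith [hT t (t + α + 1) (hTb.trans hbt) (by linarith) h]
  obtain ⟨b, ⟨hb, hb0⟩, hbmin⟩ := (isCompact_Icc.inter_right hzero :
    IsCompact (Icc t c ∩ x ⁻¹' {0})).exists_isLeast ⟨c, ⟨hc.1.le, le_rfl⟩, hc0⟩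
  refine ⟨a, b, ha.1, ha.2, hb.1, ha0, hb0, ?_⟩
  rcases (ha.2.trans hb.1).eq_or_lt with h | h
  · linarith
  refine hT a b (hTb.trans ha.1) h fun s hs hs0 => ?_
  rcases le_total s t with hst | hst
  · exact absurd (hamax ⟨⟨ha.1.trans hs.1.le, hst⟩, hs0⟩) (not_le.2 hs.1)
  · exact absurd (hbmin ⟨⟨hst, hs.2.le.trans hb.2⟩, hs0⟩) (not_le.2 hs.2)

/-- A bound valid on one history interval before a zero persists. -/
lemma abs_le_of_history
    (hxc : Continuous x) (hτdle : ∀ t, τd t ≤ t) (hdel : ∀ s ≥ t₀, s - τ ≤ τd s)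
    (hstep : ∀ ⦃a b : ℝ⦄, t₀ ≤ a → a ≤ b → ∀ ⦃G : ℝ → ℝ⦄, ContinuousOn G (Icc a b) →
      (∀ s ∈ Icc a b, |x (τd s)| ≤ G s) → |x b - x a| ≤ ∫ s in a..b, G s)
    (hy : IsXSol τ y) (hψ : IsPsiSol τ (firstRoot y) y ψ) (hτ : 0 < τ)
    {Λ : ℝ} (hα : 0 < α) (hΛ : firstRoot y < Λ ∧ ψ (Λ - firstRoot y) = 1)
    (hαΛ : α ≤ Λ) {T : ℝ}
    (hT : ∀ a b : ℝ, T ≤ a → a < b → (∀ t ∈ Ioo a b, x t ≠ 0) → b - a ≤ α)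
    {b₀ M : ℝ} (hMpos : 0 < M) (hTb : T ≤ b₀) (hb : t₀ + firstRoot y ≤ b₀) (hb₀ : x b₀ = 0)
    (hM : ∀ t ∈ Icc (b₀ - firstRoot y - τ) b₀, |x t| ≤ M) {t : ℝ} (ht : b₀ ≤ t) :
    |x t| ≤ M := by
  set ρ := firstRoot y with hρ
  have hρ0 : 0 ≤ ρ := firstRoot_nonneg y
  by_contra! hviol
  have hbdd : BddBelow {s | b₀ ≤ s ∧ M < |x s|} := ⟨b₀, fun _ hs => hs.1⟩
  have hne : {s | b₀ ≤ s ∧ M < |x s|}.Nonempty := ⟨t, ht, hviol⟩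
  set r := sInf {s | b₀ ≤ s ∧ M < |x s|} with hr
  have hbr : b₀ ≤ r := le_csInf hne fun _ hs => hs.1
  have hbefore : ∀ s ∈ Ico (b₀ - ρ - τ) r, |x s| ≤ M := by
    intro s hs
    rcases le_or_gt s b₀ with h | h
    · exact hM s ⟨hs.1, h⟩
    · by_contra! hs'
      exact absurd (csInf_le hbdd ⟨h.le, hs'⟩) (not_le.2 hs.2)
  have hr_le : |x r| ≤ M := by
    refine ContinuousWithinAt.closure_le (s := Ico (b₀ - ρ - τ) r) (x := r) ?_
      hxc.abs.continuousWithinAt continuousWithinAt_const hbefore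
    have : b₀ - ρ - τ < r := by linarith
    rw [closure_Ico this.ne]
    exact ⟨this.le, le_rfl⟩
  obtain ⟨a, b, hba, har, hrb, ha0, hb0, hab⟩ := exists_zero_Icc hxc hα hT hTb hb₀ hbr
  obtain ⟨c, hc, hcmax⟩ := isCompact_Icc.exists_isMaxOn ⟨r, har, hrb⟩
    (f := fun s => |x s|) hxc.abs.continuousOn
  have hr_ge : M ≤ |x r| :=
    closure_minimal (fun _ hs => hs.2.le) (isClosed_le continuous_const hxc.abs)
      (csInf_mem_closure hne hbdd)
  have hrb' : r < b := by
    refine hrb.lt_of_ne fun h => ?_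
    rw [h, hb0, abs_zero] at hr_ge
    linarith
  obtain ⟨s, ⟨hbs, hMs⟩, hsb⟩ := exists_lt_of_csInf_lt hne hrb'
  have hMc : M < |x c| := hMs.trans_le (hcmax ⟨har.trans (csInf_le hbdd ⟨hbs, hMs⟩), hsb.le⟩)
  have hbc : ρ ≤ b - c := by
    by_contra! h
    have h1 := abs_le_before_zero hxc hτdle hdel hstep hy hτ (M := |x c|)
      (by linarith : t₀ + ρ ≤ b) hb0 (fun u hu => by
        rcases lt_or_ge u r with hur | hur
        · exact (hbefore u ⟨by linarith [hu.1], hur⟩).trans hMc.le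
        · exact hcmax ⟨har.trans hur, hu.2⟩) (t := c) ⟨by linarith, hc.2⟩
    have h2 : y (ρ + c - b) < 1 := by
      rw [← hy.2.1 0 le_rfl]
      exact hy.lt_of_lt hτ le_rfl (by linarith) (show _ ≤ ρ by linarith [hc.2])
    nlinarith [mul_pos (hMpos.trans hMc) (sub_pos.2 h2)]
  have hca := abs_le_after_zero hxc hτdle hdel hstep hy hψ hτ (M := M)
    (by linarith : t₀ + ρ ≤ a) ha0 (fun u hu => by
      rcases (hu.2.trans har).eq_or_lt with hur | hur
      · rwa [hur]
      · exact hbefore u ⟨by linarith [hu.1], hur⟩) (sub_nonneg.2 hc.1)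
  rw [add_sub_cancel] at hca
  have hψc : ψ (c - a) ≤ 1 := by
    rw [← hΛ.2]
    exact (hψ.strictMonoOn hy hτ).monotoneOn (mem_Ici.2 (by linarith [hc.1]))
      (mem_Ici.2 (by linarith)) (by linarith)
  nlinarith [mul_nonneg hMpos.le (sub_nonneg.2 hψc)]

/-- If `α` is below the critical value, bounds contract by a uniform factor. -/
lemma exists_contraction_factor
    (hxc : Continuous x) (hτdle : ∀ t, τd t ≤ t) (hdel : ∀ s ≥ t₀, s - τ ≤ τd s)
    (hstep : ∀ ⦃a b : ℝ⦄, t₀ ≤ a → a ≤ b → ∀ ⦃G : ℝ → ℝ⦄, ContinuousOn G (Icc a b) →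
      (∀ s ∈ Icc a b, |x (τd s)| ≤ G s) → |x b - x a| ≤ ∫ s in a..b, G s)
    (hy : IsXSol τ y) (hψ : IsPsiSol τ (firstRoot y) y ψ) (hτ : 0 < τ)
    {Λ : ℝ} (hα : 0 < α)
    (hΛ : firstRoot y < Λ ∧ ψ (Λ - firstRoot y) = 1) (hαΛ : α < Λ) {T : ℝ}
    (hT : ∀ a b : ℝ, T ≤ a → a < b → (∀ t ∈ Ioo a b, x t ≠ 0) → b - a ≤ α) :
    ∃ κ : ℝ, 0 ≤ κ ∧ κ < 1 ∧ ∀ b₀ M : ℝ, T ≤ b₀ → t₀ + firstRoot y ≤ b₀ → x b₀ = 0 →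
      (∀ t ≥ b₀ - firstRoot y - τ, |x t| ≤ M) → ∀ t ≥ b₀, |x t| ≤ κ * M := by
  set ρ := firstRoot y with hρ
  have hρ0 : 0 ≤ ρ := firstRoot_nonneg y
  set δ := (Λ - α) / 2 with hδ
  have hδpos : 0 < δ := by linarith
  set m := max 0 (Λ - ρ - δ) with hm
  have hm0 : 0 ≤ m := le_max_left _ _
  have hψm : ψ m < 1 := by
    rw [← hΛ.2]
    exact hψ.strictMonoOn hy hτ (mem_Ici.2 hm0) (mem_Ici.2 (by linarith))
      (max_lt (by linarith) (by linarith))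
  have hyδ : (if δ < ρ then y δ else 0) < 1 := by
    split_ifs with h
    · rw [← hy.2.1 0 le_rfl]
      exact hy.lt_of_lt hτ le_rfl hδpos h.le
    · exact one_pos
  refine ⟨max (ψ m) (if δ < ρ then y δ else 0), le_max_of_le_left (hψ.nonneg hy hτ hm0),
    max_lt hψm hyδ, fun b₀ M hTb hb hb₀ hM t ht => ?_⟩
  have hM0 : 0 ≤ M := (abs_nonneg _).trans (hM t (by linarith))
  rw [mul_comm]
  obtain ⟨a, b, hba, hat, htb, ha0, hb0, hab⟩ := exists_zero_Icc hxc hα hT hTb hb₀ ht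
  rcases le_or_gt (t - a) m with h | h
  · have h1 := abs_le_after_zero hxc hτdle hdel hstep hy hψ hτ (M := M)
      (by linarith : t₀ + ρ ≤ a) ha0 (fun u hu => hM u (by linarith [hu.1])) (sub_nonneg.2 hat)
    rw [add_sub_cancel] at h1
    exact h1.trans (mul_le_mul_of_nonneg_left (le_max_of_le_left
      ((hψ.strictMonoOn hy hτ).monotoneOn (mem_Ici.2 (by linarith)) (mem_Ici.2 hm0) h)) hM0)
  · have h0 : Λ - ρ - δ < t - a := (le_max_right _ _).trans_lt h
    have h1 := abs_le_before_zero hxc hτdle hdel hstep hy hτ (M := M)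
      (by linarith : t₀ + ρ ≤ b) hb0 (fun u hu => hM u (by linarith [hu.1]))
      (t := t) ⟨by linarith, htb⟩
    have hδρ : δ < ρ := by linarith
    refine h1.trans (mul_le_mul_of_nonneg_left (le_max_of_le_right ?_) hM0)
    rw [if_pos hδρ]
    exact hy.antitoneOn_s8 hτ (mem_Iic.2 hδρ.le) (mem_Iic.2 (show _ ≤ ρ by linarith)) (by linarith)

end Oscillation

theorem stmt8 (p τd : ℝ → ℝ) (hpm : Measurable p)
    (hploc : MeasureTheory.LocallyIntegrable p)
    (hτdm : Measurable τd) (hτdle : ∀ t, τd t ≤ t)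
    (hτdinf : Filter.Tendsto τd Filter.atTop Filter.atTop)
    (t₀ : ℝ) (x : ℝ → ℝ) (hx : IsDelaySolution p τd t₀ x)
    (α : ℝ) (hα : 0 < α) (hosc : AlphaOscillating α x)
    (hp1 : ∀ᵐ t : ℝ ∂volume, |p t| = 1)
    (τm : ℝ) (hτm : IsLUB {y : ℝ | ∃ t ≥ t₀, y = t - τd t} τm)
    (hτmI : τm ∈ Ioc (1 / Real.exp 1) 2)
    (xτ : ℝ → ℝ) (hxτ : IsXSol τm xτ) (ρ : ℝ) (hρ : ρ = firstRoot xτ)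
    (ψ : ℝ → ℝ) (hψ : IsPsiSol τm ρ xτ ψ)
    (Λτ : ℝ) (hΛ : ρ < Λτ ∧ ψ (Λτ - ρ) = 1) :
    (α ≤ Λτ → ∃ B : ℝ, ∀ t ≥ t₀, |x t| ≤ B) ∧
    (α < Λτ → Filter.Tendsto x Filter.atTop (nhds 0)) := by
  subst hρ
  have hτ : 0 < τm := (one_div_pos.2 (exp_pos 1)).trans hτmI.1
  have hdel : ∀ s ≥ t₀, s - τm ≤ τd s := fun s hs => by
    linarith [hτm.1 ⟨s, hs, rfl⟩]
  have hstep : ∀ ⦃a b : ℝ⦄, t₀ ≤ a → a ≤ b → ∀ ⦃G : ℝ → ℝ⦄, ContinuousOn G (Icc a b) →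
      (∀ s ∈ Icc a b, |x (τd s)| ≤ G s) → |x b - x a| ≤ ∫ s in a..b, G s :=
    fun _ _ ha hab _ hG hle => hx.abs_sub_le hpm hτdm hp1 hτdle hdel ha hab hG hle
  obtain ⟨T, hT⟩ := hosc
  have hzero : ∀ S : ℝ, ∃ b ≥ S, T ≤ b ∧ t₀ + firstRoot xτ ≤ b ∧ x b = 0 := by
    intro S
    set R := max S (max T (t₀ + firstRoot xτ))
    have hR : S ≤ R ∧ T ≤ R ∧ t₀ + firstRoot xτ ≤ R :=
      ⟨le_max_left _ _, (le_max_left _ _).trans (le_max_right _ _),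
        (le_max_right _ _).trans (le_max_right _ _)⟩
    obtain ⟨b, hb, hb0⟩ : ∃ b ∈ Ioo R (R + α + 1), x b = 0 := by
      by_contra! h
      linarith [hT R (R + α + 1) hR.2.1 (by linarith) h]
    exact ⟨b, hR.1.trans hb.1.le, hR.2.1.trans hb.1.le, hR.2.2.trans hb.1.le, hb0⟩
  have hbounded : α ≤ Λτ → ∃ B : ℝ, ∀ t ≥ t₀, |x t| ≤ B := by
    intro hαΛ
    obtain ⟨b₀, -, hTb, hb, hb₀⟩ := hzero 0
    have hρ0 := firstRoot_nonneg xτ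
    obtain ⟨C, hC⟩ := (isCompact_Icc (a := t₀ - τm) (b := b₀)).exists_bound_of_continuousOn
      hx.1.continuousOn
    have hC0 : 0 ≤ C := (norm_nonneg _).trans (hC b₀ ⟨by linarith, le_rfl⟩)
    refine ⟨C + 1, fun t ht => ?_⟩
    rcases le_total t b₀ with h | h
    · exact (hC t ⟨by linarith, h⟩).trans (by linarith)
    · exact abs_le_of_history hx.1 hτdle hdel hstep hxτ hψ hτ hα hΛ hαΛ hT (by linarith) hTb hb
        hb₀ (fun s hs => (hC s ⟨by linarith [hs.1], hs.2⟩).trans (by linarith)) h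
  refine ⟨hbounded, fun hαΛ => ?_⟩
  obtain ⟨B, hB⟩ := hbounded hαΛ.le
  obtain ⟨κ, hκ0, hκ1, hκ⟩ :=
    exists_contraction_factor hx.1 hτdle hdel hstep hxτ hψ hτ hα hΛ hαΛ hT
  have hiter : ∀ n : ℕ, ∃ S : ℝ, ∀ t ≥ S, |x t| ≤ κ ^ n * B := by
    intro n
    induction n with
    | zero => exact ⟨t₀, by simpa using hB⟩
    | succ n ih =>
      obtain ⟨S, hS⟩ := ih
      obtain ⟨b, hbS, hTb, hb, hb0⟩ := hzero (S + firstRoot xτ + τm)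
      refine ⟨b, fun t ht => ?_⟩
      rw [pow_succ', mul_assoc]
      exact hκ b _ hTb hb hb0 (fun s hs => hS s (by linarith)) t ht
  have hlim : Tendsto (fun n : ℕ => κ ^ n * B) atTop (nhds 0) := by
    simpa using (tendsto_pow_atTop_nhds_zero_of_lt_one hκ0 hκ1).mul_const B
  rw [Metric.tendsto_atTop]
  intro ε hε
  obtain ⟨n, hn⟩ := (hlim.eventually_lt_const hε).exists
  obtain ⟨S, hS⟩ := hiter n
  exact ⟨S, fun t ht => by simpa using (hS t ht).trans_lt hn⟩
end
end
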